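/- arXiv:2008.09989 — 2 statements merged into one kernel-verified Lean document; each statement's English description precedes it below -/
import Mathlib

section
/- Let N ≥ 1 and let f : ℝ → ℝ be continuously differentiable with f(0) = 0 and f'(0) < 0. If u : ℝ^N → ℝ is a classical solution of Δu + f(u) = 0 in ℝ^N with u(x) → 0 as |x| → ∞, then u and its gradient decay exponentially fast: there exist constants C > 0 and α > 0 such that |u(x)| ≤ C e^{−α|x|} and |∇u(x)| ≤ C e^{−α|x|} for all x ∈ ℝ^N. -/
open MeasureTheory Filter

/-- The Laplacian of `u : ℝ^N → ℝ`: the sum of the second pure partial derivatives. -/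
noncomputable def coordLaplacian {N : ℕ} (u : EuclideanSpace ℝ (Fin N) → ℝ)
    (x : EuclideanSpace ℝ (Fin N)) : ℝ :=
  ∑ i : Fin N,
    fderiv ℝ (fun y => fderiv ℝ u y (EuclideanSpace.single i 1)) x (EuclideanSpace.single i 1)

open scoped Topology

section SecondLineDerivative

variable {E : Type*} [NormedAddCommGroup E] [NormedSpace ℝ E]

/-- `φ` is differentiable along the line through `x` with direction `e`, and `d` is its second
derivative along this line at `x`. -/
def HasSecondLineDerivAt (φ : E → ℝ) (x e : E) (d : ℝ) : Prop :=
  ∃ g' : ℝ → ℝ, (∀ s, HasDerivAt (fun s : ℝ => φ (x + s • e)) (g' s) s) ∧ HasDerivAt g' d 0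

theorem HasSecondLineDerivAt.sub {φ ψ : E → ℝ} {x e : E} {a b : ℝ}
    (hφ : HasSecondLineDerivAt φ x e a) (hψ : HasSecondLineDerivAt ψ x e b) :
    HasSecondLineDerivAt (fun y => φ y - ψ y) x e (a - b) := by
  obtain ⟨p, hp, hp'⟩ := hφ
  obtain ⟨q, hq, hq'⟩ := hψ
  exact ⟨fun s => p s - q s, fun s => (hp s).sub (hq s), hp'.sub hq'⟩

/-- Second line derivatives commute with affine changes of variables. -/
theorem HasSecondLineDerivAt.comp_affine {φ : E → ℝ} {T : E → E} {x e e' : E} {d : ℝ}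
    (hφ : HasSecondLineDerivAt φ (T x) e' d) (hT : ∀ s : ℝ, T (x + s • e) = T x + s • e') :
    HasSecondLineDerivAt (fun y => φ (T y)) x e d := by
  obtain ⟨p, hp, hp'⟩ := hφ
  exact ⟨p, fun s => by simpa only [hT] using hp s, hp'⟩

theorem hasSecondLineDerivAt_of_quadratic {φ : E → ℝ} {x e : E} {a b c : ℝ}
    (h : ∀ s : ℝ, φ (x + s • e) = a + b * s + c * s ^ 2) :
    HasSecondLineDerivAt φ x e (2 * c) := by
  refine ⟨fun s => b + 2 * c * s, fun s => ?_, ?_⟩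
  · simp only [h]
    have := (((hasDerivAt_id s).const_mul b).const_add a).add
      (((hasDerivAt_id s).pow 2).const_mul c)
    exact this.congr_deriv (by simp; ring)
  · simpa using ((hasDerivAt_id (0 : ℝ)).const_mul (2 * c)).const_add b

theorem hasSecondLineDerivAt_cosh {φ : E → ℝ} {x e : E} {a b k m : ℝ}
    (h : ∀ s : ℝ, φ (x + s • e) = m + k * Real.cosh (a + b * s)) :
    HasSecondLineDerivAt φ x e (k * b ^ 2 * Real.cosh a) := by
  have hl : ∀ s : ℝ, HasDerivAt (fun s : ℝ => a + b * s) b s := fun s => by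
    simpa using ((hasDerivAt_id s).const_mul b).const_add a
  refine ⟨fun s => k * (Real.sinh (a + b * s) * b), fun s => ?_, ?_⟩
  · simp only [h]
    exact ((hl s).cosh.const_mul k).const_add m
  · exact (((hl 0).sinh.mul_const b).const_mul k).congr_deriv (by simp; ring)

theorem ContDiff.hasSecondLineDerivAt {u : E → ℝ} (hu : ContDiff ℝ 2 u) (x e : E) :
    HasSecondLineDerivAt u x e (fderiv ℝ (fun y => fderiv ℝ u y e) x e) := by
  have hl : ∀ s : ℝ, HasDerivAt (fun s : ℝ => x + s • e) e s := fun s => by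
    simpa using ((hasDerivAt_id s).smul_const e).const_add x
  have hd : Differentiable ℝ u := hu.differentiable (by norm_num)
  have hd' : Differentiable ℝ (fun y => fderiv ℝ u y e) :=
    ((hu.fderiv_right (m := 1) (by norm_num)).clm_apply contDiff_const).differentiable
      (by norm_num)
  refine ⟨fun s => fderiv ℝ u (x + s • e) e, fun s => ?_, ?_⟩
  · exact (hd _).hasFDerivAt.comp_hasDerivAt s (hl s)
  · have h0 : HasFDerivAt (fun y => fderiv ℝ u y e) (fderiv ℝ (fun y => fderiv ℝ u y e) x)
        (x + (0 : ℝ) • e) := by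
      simpa using (hd' x).hasFDerivAt
    exact h0.comp_hasDerivAt 0 (hl 0)

theorem HasSecondLineDerivAt.nonpos_of_isLocalMax {φ : E → ℝ} {x e : E} {d : ℝ}
    (hφ : HasSecondLineDerivAt φ x e d) (hmax : IsLocalMax φ x) : d ≤ 0 := by
  obtain ⟨g', hg, hg'⟩ := hφ
  set g : ℝ → ℝ := fun s => φ (x + s • e) with hgdef
  have hc : Tendsto (fun s : ℝ => x + s • e) (𝓝 0) (𝓝 x) := by
    have : Continuous (fun s : ℝ => x + s • e) := by fun_prop
    simpa using this.tendsto 0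
  have hgmax : IsLocalMax g 0 := by
    have h := hc.eventually hmax
    simpa [IsLocalMax, IsMaxFilter, hgdef] using h
  have hderiv : deriv g = g' := funext fun s => (hg s).deriv
  by_contra! hd
  have hgmin : IsLocalMin g 0 := isLocalMin_of_deriv_deriv_pos
    (by rw [hderiv, hg'.deriv]; exact hd) hgmax.deriv_eq_zero (hg 0).continuousAt
  have hconst : g =ᶠ[𝓝 0] fun _ => g 0 := by
    filter_upwards [hgmax, hgmin] with s h1 h2 using le_antisymm h1 h2
  have hzero : g' =ᶠ[𝓝 0] fun _ => (0 : ℝ) := by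
    have := hconst.deriv
    rw [hderiv] at this
    simpa using this
  have := hzero.deriv_eq
  rw [hg'.deriv] at this
  simp at this
  exact hd.ne' this

end SecondLineDerivative

section MaximumPrinciple

variable {N : ℕ}

/-- A maximum principle on compact sets, in terms of second line derivatives. -/
theorem nonpos_of_sum_secondLineDeriv_pos {K : Set (EuclideanSpace ℝ (Fin N))} (hK : IsCompact K)
    {φ : EuclideanSpace ℝ (Fin N) → ℝ} (hφ : ContinuousOn φ K)
    (h : ∀ x ∈ K, 0 < φ x → K ∈ 𝓝 x ∧ ∃ d : Fin N → ℝ,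
      (∀ j, HasSecondLineDerivAt φ x (EuclideanSpace.single j 1) (d j)) ∧ 0 < ∑ j, d j)
    {x : EuclideanSpace ℝ (Fin N)} (hx : x ∈ K) : φ x ≤ 0 := by
  obtain ⟨z, hz, hmax⟩ := hK.exists_isMaxOn ⟨x, hx⟩ hφ
  refine (hmax hx).trans ?_
  by_contra! hpos
  obtain ⟨hnhds, d, hd, hsum⟩ := h z hz hpos
  exact hsum.not_ge
    (Finset.sum_nonpos fun j _ => (hd j).nonpos_of_isLocalMax (hmax.isLocalMax hnhds))

theorem coordLaplacian_neg (u : EuclideanSpace ℝ (Fin N) → ℝ) (x : EuclideanSpace ℝ (Fin N)) :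
    coordLaplacian (fun y => -u y) x = -coordLaplacian u x := by
  simp [coordLaplacian, fderiv_fun_neg]

/-- Interior exponential bound for subsolutions of `Δv = c v`. -/
theorem le_of_coordLaplacian_ge {v : EuclideanSpace ℝ (Fin N) → ℝ} (hv : ContDiff ℝ 2 v)
    (hN : 1 ≤ N) {c δ r : ℝ} (hc : 0 < c) (hδ : 0 < δ) (hr : 0 ≤ r)
    {y : EuclideanSpace ℝ (Fin N)}
    (hle : ∀ x ∈ Metric.closedBall y r, v x ≤ δ)
    (hsub : ∀ x ∈ Metric.closedBall y r, 0 < v x → c * v x ≤ coordLaplacian v x) :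
    v y ≤ 2 * δ * N * Real.exp (-(√c / √N) * r) := by
  have hN0 : (0 : ℝ) < N := by exact_mod_cast hN
  set β := √c
  have hβ : β ^ 2 = c := Real.sq_sqrt hc.le
  have hβ0 : 0 < β := Real.sqrt_pos.2 hc
  set A := δ / Real.cosh (β * (r / √N)) with hA
  have hcosh := Real.cosh_pos (β * (r / √N))
  have hA0 : 0 < A := div_pos hδ hcosh
  set w : EuclideanSpace ℝ (Fin N) → ℝ := fun x => ∑ j, A * Real.cosh (β * (x j - y j)) with hw
  have hw0 : ∀ x, 0 < w x := fun x => by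
    have : Nonempty (Fin N) := ⟨⟨0, hN⟩⟩
    exact Finset.sum_pos (fun j _ => mul_pos hA0 (Real.cosh_pos _)) Finset.univ_nonempty
  have hbdry : ∀ x, dist x y = r → δ ≤ w x := by
    intro x hx
    obtain ⟨j, -, hj⟩ : ∃ j ∈ (Finset.univ : Finset (Fin N)), r ^ 2 / N ≤ (x j - y j) ^ 2 := by
      apply Finset.exists_le_of_sum_le ⟨⟨0, hN⟩, Finset.mem_univ _⟩
      rw [← hx, EuclideanSpace.dist_eq, Real.sq_sqrt (by positivity)]
      simp only [Real.dist_eq, sq_abs, Finset.sum_const, Finset.card_univ, Fintype.card_fin,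
        nsmul_eq_mul]
      rw [mul_div_cancel₀ _ hN0.ne']
    have hj' : r / √N ≤ |x j - y j| := by
      apply le_of_sq_le_sq _ (abs_nonneg _)
      rwa [div_pow, Real.sq_sqrt hN0.le, sq_abs]
    calc δ = A * Real.cosh (β * (r / √N)) := by rw [hA]; field_simp
      _ ≤ A * Real.cosh (β * (x j - y j)) := by
        gcongr
        rw [Real.cosh_le_cosh, abs_mul, abs_mul, abs_of_nonneg (by positivity : 0 ≤ r / √N)]
        gcongr
      _ ≤ w x := Finset.single_le_sum (f := fun j => A * Real.cosh (β * (x j - y j)))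
        (fun k _ => (mul_pos hA0 (Real.cosh_pos _)).le) (Finset.mem_univ j)
  have hmain : v y - w y ≤ 0 := by
    refine nonpos_of_sum_secondLineDeriv_pos (isCompact_closedBall y r) (φ := fun x => v x - w x)
      ?_ ?_ (Metric.mem_closedBall_self hr)
    · have : Continuous w := by fun_prop
      exact (hv.continuous.sub this).continuousOn
    · intro x hx hpos
      have hvx : w x < v x := by linarith
      have hlt : dist x y < r := lt_of_le_of_ne hx fun h => by
        linarith [hbdry x h, hle x hx]
      refine ⟨Metric.closedBall_mem_nhds_of_mem hlt, _, fun j =>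
        (hv.hasSecondLineDerivAt x _).sub (hasSecondLineDerivAt_cosh
          (a := β * (x j - y j)) (b := β) (k := A)
          (m := ∑ i ∈ Finset.univ.erase j, A * Real.cosh (β * (x i - y i))) fun s => ?_), ?_⟩
      · simp only [hw]
        rw [← Finset.sum_erase_add _ _ (Finset.mem_univ j)]
        congr 1
        · refine Finset.sum_congr rfl fun i hi => ?_
          simp [Finset.ne_of_mem_erase hi]
        · rw [show (x + s • EuclideanSpace.single j (1 : ℝ)) j = x j + s by simp]
          ring_nf
      · have h1 := hsub x hx ((hw0 x).trans hvx)
        have h2 : c * w x < c * v x := by gcongr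
        rw [Finset.sum_sub_distrib]
        change 0 < coordLaplacian v x - _
        have h3 : ∑ j, A * β ^ 2 * Real.cosh (β * (x j - y j)) = c * w x := by
          rw [hw, Finset.mul_sum, hβ]
          exact Finset.sum_congr rfl fun _ _ => by ring
        rw [h3]
        linarith
  have hwy : w y = N * A := by simp [hw]
  have hexp : Real.exp (β / √N * r) / 2 ≤ Real.cosh (β * (r / √N)) := by
    rw [Real.cosh_eq, show β / √N * r = β * (r / √N) by ring]
    linarith [Real.exp_pos (-(β * (r / √N)))]
  have hAle : A ≤ 2 * δ * Real.exp (-(β / √N) * r) := by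
    rw [neg_mul, Real.exp_neg, hA, div_le_iff₀ hcosh]
    have := Real.exp_pos (β / √N * r)
    calc δ = 2 * δ * (Real.exp (β / √N * r))⁻¹ * (Real.exp (β / √N * r) / 2) := by field_simp
      _ ≤ _ := by gcongr
  calc v y ≤ N * A := by linarith
    _ ≤ N * (2 * δ * Real.exp (-(β / √N) * r)) := by gcongr
    _ = _ := by ring

/-- One-sided interior gradient estimate for Poisson's equation, proved by comparing the odd part
of `v` with a quadratic barrier on a half ball. -/
theorem fderiv_single_le_of_abs_le {v : EuclideanSpace ℝ (Fin N) → ℝ} (hv : ContDiff ℝ 2 v)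
    {M L : ℝ} (y : EuclideanSpace ℝ (Fin N)) (hM : ∀ x ∈ Metric.closedBall y 1, |v x| ≤ M)
    (hL : ∀ x ∈ Metric.closedBall y 1, |coordLaplacian v x| < L) (i : Fin N) :
    fderiv ℝ v y (EuclideanSpace.single i 1) ≤ N * M + L / 2 := by
  set e : EuclideanSpace ℝ (Fin N) := EuclideanSpace.single i 1 with he
  have hM0 : 0 ≤ M := (abs_nonneg _).trans (hM y (Metric.mem_closedBall_self zero_le_one))
  have hL0 : 0 < L := (abs_nonneg _).trans_lt (hL y (Metric.mem_closedBall_self zero_le_one))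
  set D := N * (2 * M) + L with hD
  have hD0 : 0 ≤ D := by positivity
  set R : EuclideanSpace ℝ (Fin N) → EuclideanSpace ℝ (Fin N) := fun x => x - (2 * x i) • e
    with hR
  have hRnorm : ∀ x, ‖R x‖ = ‖x‖ := by
    intro x
    rw [EuclideanSpace.norm_eq, EuclideanSpace.norm_eq]
    congr 1
    refine Finset.sum_congr rfl fun j _ => ?_
    by_cases hj : j = i
    · subst hj
      simp [hR, he]
      ring
    · simp [hR, he, hj]
  have hRdir : ∀ (j : Fin N) (x : EuclideanSpace ℝ (Fin N)) (s : ℝ),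
      R (x + s • EuclideanSpace.single j 1) =
        R x + s • (if j = i then -EuclideanSpace.single j 1 else EuclideanSpace.single j 1) := by
    intro j x s
    by_cases hj : j = i
    · subst hj
      ext k
      by_cases hk : k = j <;> simp [hR, he, hk]
      ring
    · ext k
      simp [hR, he, hj, Ne.symm hj]
      ring
  set ψ : EuclideanSpace ℝ (Fin N) → ℝ := fun x => 2 * M * ‖x‖ ^ 2 + D * x i - D * x i ^ 2 with hψ
  set φ : EuclideanSpace ℝ (Fin N) → ℝ := fun x => v (y + x) - v (y + R x) - ψ x with hφ
  have hRc : Continuous R := by fun_prop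
  have hφc : Continuous φ := by
    have := hv.continuous
    fun_prop
  set K : Set (EuclideanSpace ℝ (Fin N)) := Metric.closedBall 0 1 ∩ {x | 0 ≤ x i}
  have hK : IsCompact K := (isCompact_closedBall 0 1).inter_right
    (isClosed_le continuous_const (by fun_prop))
  have hball : ∀ x : EuclideanSpace ℝ (Fin N), ‖x‖ ≤ 1 → y + x ∈ Metric.closedBall y 1 :=
    fun x hx => by simpa using hx
  have hquad : ∀ x (j : Fin N), HasSecondLineDerivAt ψ x (EuclideanSpace.single j 1)
      (2 * (2 * M - if j = i then D else 0)) := by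
    intro x j
    have hn : ∀ s : ℝ, ‖x + s • EuclideanSpace.single j (1 : ℝ)‖ ^ 2
        = ‖x‖ ^ 2 + 2 * s * x j + s ^ 2 := by
      intro s
      rw [norm_add_sq_real, norm_smul, inner_smul_right, EuclideanSpace.inner_single_right]
      simp
      ring
    by_cases hj : j = i
    · subst hj
      refine hasSecondLineDerivAt_of_quadratic (a := ψ x)
        (b := 4 * M * x j + D - 2 * D * x j) fun s => ?_
      simp only [hψ, hn]
      simp
      ring
    · refine hasSecondLineDerivAt_of_quadratic (a := ψ x) (b := 4 * M * x j) fun s => ?_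
      simp only [hψ, hn]
      simp [hj, Ne.symm hj]
      ring
  have hle : ∀ x ∈ K, φ x ≤ 0 := by
    intro x₀ hx₀
    refine nonpos_of_sum_secondLineDeriv_pos hK hφc.continuousOn ?_ hx₀
    rintro x ⟨hx1, hx2⟩ hpos
    rw [mem_closedBall_zero_iff] at hx1
    simp only [Set.mem_ofPred_eq] at hx2
    have hx3 : x i ≤ 1 := (le_abs_self _).trans ((PiLp.norm_apply_le x i).trans hx1)
    have hi : 0 < x i := by
      refine lt_of_le_of_ne hx2 fun h => ?_
      have : φ x = -(2 * M * ‖x‖ ^ 2) := by simp [hφ, hR, hψ, ← h]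
      have : 0 ≤ 2 * M * ‖x‖ ^ 2 := by positivity
      linarith
    have hlt : ‖x‖ < 1 := by
      refine lt_of_le_of_ne hx1 fun h => ?_
      have h1 := abs_le.1 (hM _ (hball x hx1))
      have h2 := abs_le.1 (hM _ (hball (R x) (by rw [hRnorm]; exact hx1)))
      have h3 : 0 ≤ D * (x i * (1 - x i)) :=
        mul_nonneg hD0 (mul_nonneg hx2 (by linarith))
      have h4 : φ x = v (y + x) - v (y + R x) - 2 * M - D * (x i * (1 - x i)) := by
        simp only [hφ, hψ, h]
        ring
      linarith
    refine ⟨?_, _, fun j => ((((hv.hasSecondLineDerivAt (y + x) _).comp_affine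
      (T := fun x => y + x) fun s => by rw [add_assoc]).sub
      ((hv.hasSecondLineDerivAt (y + R x) _).comp_affine (T := fun x => y + R x) fun s => by
        rw [hRdir, add_assoc])).sub (hquad x j)), ?_⟩
    · refine inter_mem ?_ ?_
      · exact Metric.closedBall_mem_nhds_of_mem (by simpa using hlt)
      · have : {x : EuclideanSpace ℝ (Fin N) | 0 < x i} ∈ 𝓝 x :=
          (isOpen_lt continuous_const (by fun_prop)).mem_nhds hi
        exact mem_of_superset this fun z (hz : 0 < z i) => hz.le
    · have h1 := abs_lt.1 (hL _ (hball x hx1))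
      have h2 := abs_lt.1 (hL _ (hball (R x) (by rw [hRnorm]; exact hx1)))
      rw [Finset.sum_sub_distrib, Finset.sum_sub_distrib]
      have h3 : ∑ j, fderiv ℝ (fun z => fderiv ℝ v z (if j = i then -EuclideanSpace.single j 1
          else EuclideanSpace.single j 1)) (y + R x)
          (if j = i then -EuclideanSpace.single j 1 else EuclideanSpace.single j 1)
          = coordLaplacian v (y + R x) := by
        refine Finset.sum_congr rfl fun j _ => ?_
        by_cases hj : j = i <;> simp [hj, fderiv_fun_neg]
      have h4 : ∑ j, 2 * (2 * M - if j = i then D else 0) = 2 * (N * (2 * M)) - 2 * D := by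
        rw [← Finset.mul_sum, Finset.sum_sub_distrib]
        simp
        ring
      rw [h3, h4]
      change 0 < coordLaplacian v (y + x) - _ - _
      linarith
  have hd : DifferentiableAt ℝ v y := hv.differentiable (by norm_num) y
  have hderiv : HasDerivAt (fun t : ℝ => φ (t • e)) (2 * fderiv ℝ v y e - D) 0 := by
    have hRe : ∀ t : ℝ, R (t • e) = t • (-e) := by
      intro t
      ext k
      by_cases hk : k = i <;> simp [hR, he, hk]
      ring
    have hψe : ∀ t : ℝ, ψ (t • e) = 2 * M * t ^ 2 + D * t - D * t ^ 2 := by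
      intro t
      simp [hψ, he, norm_smul]
    have hline : ∀ a : EuclideanSpace ℝ (Fin N),
        HasDerivAt (fun t : ℝ => v (y + t • a)) (fderiv ℝ v y a) 0 := by
      intro a
      have h0 : HasFDerivAt v (fderiv ℝ v y) (y + (0 : ℝ) • a) := by simpa using hd.hasFDerivAt
      have h1 : HasDerivAt (fun t : ℝ => y + t • a) a 0 := by
        simpa using ((hasDerivAt_id (0 : ℝ)).smul_const a).const_add y
      exact h0.comp_hasDerivAt 0 h1
    have hq : HasDerivAt (fun t : ℝ => 2 * M * t ^ 2 + D * t - D * t ^ 2) D 0 := by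
      have := (((hasDerivAt_pow 2 (0 : ℝ)).const_mul (2 * M)).add
        ((hasDerivAt_id (0 : ℝ)).const_mul D)).sub ((hasDerivAt_pow 2 (0 : ℝ)).const_mul D)
      exact this.congr_deriv (by simp)
    simp only [hφ, hRe, hψe]
    exact (((hline e).sub (hline (-e))).sub hq).congr_deriv (by simp; ring)
  have hlim := hderiv.tendsto_slope_zero_right
  have hφ0 : φ 0 = 0 := by simp [hφ, hR, hψ]
  have : 2 * fderiv ℝ v y e - D ≤ 0 := by
    refine le_of_tendsto hlim ?_
    filter_upwards [Ioo_mem_nhdsGT (zero_lt_one : (0 : ℝ) < 1)] with t ht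
    have hmem : t • e ∈ K := by
      refine ⟨?_, ?_⟩
      · simpa [he, norm_smul, abs_of_pos ht.1] using ht.2.le
      · simpa [he] using ht.1.le
    have := hle _ hmem
    simp only [zero_add, zero_smul, hφ0, sub_zero, smul_eq_mul]
    exact mul_nonpos_of_nonneg_of_nonpos (inv_nonneg.2 ht.1.le) this
  rw [hD] at this
  linarith

/-- Interior gradient estimate for Poisson's equation on unit balls. -/
theorem norm_gradient_le_of_abs_le {v : EuclideanSpace ℝ (Fin N) → ℝ} (hv : ContDiff ℝ 2 v)
    {M L : ℝ} (y : EuclideanSpace ℝ (Fin N)) (hM : ∀ x ∈ Metric.closedBall y 1, |v x| ≤ M)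
    (hL : ∀ x ∈ Metric.closedBall y 1, |coordLaplacian v x| < L) :
    ‖gradient v y‖ ≤ N * (N * M + L / 2) := by
  have hcoord : ∀ i, |gradient v y i| ≤ N * M + L / 2 := by
    intro i
    have hi : gradient v y i = fderiv ℝ v y (EuclideanSpace.single i 1) := by
      have h := InnerProductSpace.toDual_symm_apply (𝕜 := ℝ)
        (x := EuclideanSpace.single i (1 : ℝ)) (y := fderiv ℝ v y)
      rw [EuclideanSpace.inner_single_right] at h
      simpa [gradient] using h
    rw [hi]
    refine abs_le'.2 ⟨fderiv_single_le_of_abs_le hv y hM hL i, ?_⟩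
    have := fderiv_single_le_of_abs_le (v := fun x => -v x) (M := M) (L := L) hv.neg y
      (by simpa using hM) (by simpa [coordLaplacian_neg] using hL) i
    simpa [fderiv_fun_neg] using this
  calc ‖gradient v y‖ = ‖∑ i, gradient v y i • EuclideanSpace.single i (1 : ℝ)‖ := by
        congr 1
        ext k
        simp [Finset.sum_apply, Pi.single_apply]
    _ ≤ ∑ i, ‖gradient v y i • EuclideanSpace.single i (1 : ℝ)‖ := norm_sum_le _ _
    _ ≤ ∑ _i : Fin N, (N * M + L / 2) := by
        refine Finset.sum_le_sum fun i _ => ?_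
        simpa [norm_smul] using hcoord i
    _ = N * (N * M + L / 2) := by
        rw [Finset.sum_const, Finset.card_univ, Fintype.card_fin, nsmul_eq_mul]

end MaximumPrinciple

/-- Near a zero with negative derivative, a function is dominated by a decreasing linear one. -/
theorem exists_mul_le_neg_of_deriv_neg {f : ℝ → ℝ} (hf : DifferentiableAt ℝ f 0) (hf0 : f 0 = 0)
    (hf'0 : deriv f 0 < 0) :
    ∃ c > 0, ∃ δ > 0, ∀ s, |s| ≤ δ →
      (0 < s → c * s ≤ -f s) ∧ (s < 0 → c * -s ≤ f s) := by
  have h := hf.hasDerivAt.isLittleO.def (c := -deriv f 0 / 2) (by linarith)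
  obtain ⟨ε, hε, hball⟩ := Metric.eventually_nhds_iff.1 h
  refine ⟨-deriv f 0 / 2, by linarith, ε / 2, by linarith, fun s hs => ?_⟩
  have hb := hball (y := s) (by rw [Real.dist_eq, sub_zero]; linarith)
  simp only [hf0, sub_zero, smul_eq_mul, Real.norm_eq_abs] at hb
  have hb' := abs_le.1 hb
  refine ⟨fun h => ?_, fun h => ?_⟩
  · rw [abs_of_pos h] at hb'
    linarith
  · rw [abs_of_neg h] at hb'
    linarith

theorem stmt_7 {N : ℕ} (hN : 1 ≤ N) (f : ℝ → ℝ) (hf : ContDiff ℝ 1 f) (hf0 : f 0 = 0)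
    (hf'0 : deriv f 0 < 0)
    (u : EuclideanSpace ℝ (Fin N) → ℝ) (hu : ContDiff ℝ 2 u)
    (heq : ∀ x, coordLaplacian u x + f (u x) = 0)
    (hloc : Tendsto u (cocompact (EuclideanSpace ℝ (Fin N))) (nhds 0)) :
    ∃ C > 0, ∃ α > 0, ∀ x : EuclideanSpace ℝ (Fin N),
      |u x| ≤ C * Real.exp (-α * ‖x‖) ∧ ‖gradient u x‖ ≤ C * Real.exp (-α * ‖x‖) := by
  have hN0 : (0 : ℝ) < N := by exact_mod_cast hN
  have hlap : ∀ x, coordLaplacian u x = -f (u x) := fun x => by linarith [heq x]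
  obtain ⟨c, hc, δ, hδ, hcδ⟩ :=
    exists_mul_le_neg_of_deriv_neg (hf.differentiable (by norm_num) 0) hf0 hf'0
  obtain ⟨r₀, hr₀⟩ : ∃ r₀, ∀ x, r₀ ≤ ‖x‖ → |u x| ≤ δ := by
    have h1 : ∀ᶠ x in cocompact (EuclideanSpace ℝ (Fin N)), |u x| ≤ δ := by
      filter_upwards [hloc (Metric.closedBall_mem_nhds 0 hδ)] with x hx
      simpa using hx
    rw [← Metric.cobounded_eq_cocompact, ← comap_norm_atTop, eventually_comap, eventually_atTop] at h1
    obtain ⟨r, hr⟩ := h1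
    exact ⟨r, fun x hx => hr ‖x‖ hx x rfl⟩
  obtain ⟨B, hB⟩ : ∃ B, ∀ x, |u x| ≤ B := by
    obtain ⟨B, hB⟩ := (isCompact_closedBall (0 : EuclideanSpace ℝ (Fin N))
      r₀).exists_bound_of_continuousOn hu.continuous.continuousOn
    refine ⟨max B δ, fun x => ?_⟩
    rcases le_total ‖x‖ r₀ with h | h
    · exact (hB x (by simpa using h)).trans (le_max_left _ _)
    · exact (hr₀ x h).trans (le_max_right _ _)
  have hB0 : 0 ≤ B := (abs_nonneg _).trans (hB 0)
  obtain ⟨Λ, hΛ⟩ : ∃ Λ : NNReal, LipschitzOnWith Λ f (Set.Icc (-B) B) :=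
    hf.contDiffOn.exists_lipschitzOnWith (by norm_num) (convex_Icc _ _) isCompact_Icc
  have hfΛ : ∀ x, |f (u x)| ≤ Λ * |u x| := by
    intro x
    have := hΛ.dist_le_mul (u x) (abs_le.1 (hB x)) 0 ⟨by linarith, hB0⟩
    simpa [Real.dist_eq, hf0] using this
  set α := √c / √N with hα
  have hα0 : 0 < α := by positivity
  set C := max B (2 * δ * N) * Real.exp (α * r₀) with hC
  have hC0 : 0 < C := mul_pos (lt_max_of_lt_right (by positivity)) (Real.exp_pos _)
  have hdecay : ∀ x, |u x| ≤ C * Real.exp (-α * ‖x‖) := by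
    intro y
    rw [hC, mul_assoc, ← Real.exp_add]
    rcases le_total ‖y‖ r₀ with h | h
    · calc |u y| ≤ max B (2 * δ * N) * 1 := by
            rw [mul_one]; exact (hB y).trans (le_max_left _ _)
        _ ≤ _ := by
            gcongr
            rw [Real.one_le_exp_iff]
            nlinarith
    · have hfar : ∀ x ∈ Metric.closedBall y (‖y‖ - r₀), |u x| ≤ δ := by
        intro x hx
        apply hr₀
        rw [mem_closedBall_iff_norm'] at hx
        linarith [norm_sub_norm_le y x]
      have hbound : |u y| ≤ 2 * δ * N * Real.exp (-(√c / √N) * (‖y‖ - r₀)) := by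
        refine abs_le'.2 ⟨?_, ?_⟩
        · refine le_of_coordLaplacian_ge hu hN hc hδ (by linarith)
            (fun x hx => (abs_le.1 (hfar x hx)).2) fun x hx hpos => ?_
          rw [hlap]
          exact (hcδ _ (hfar x hx)).1 hpos
        · refine le_of_coordLaplacian_ge (v := fun x => -u x) hu.neg hN hc hδ (by linarith)
            (fun x hx => neg_le.1 (abs_le.1 (hfar x hx)).1) fun x hx hpos => ?_
          rw [coordLaplacian_neg, hlap, neg_neg]
          exact (hcδ _ (hfar x hx)).2 (by linarith)
      calc |u y| ≤ _ := hbound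
        _ ≤ max B (2 * δ * N) * Real.exp (-(√c / √N) * (‖y‖ - r₀)) := by
            gcongr
            exact le_max_right _ _
        _ = _ := by
            rw [← hα]
            ring_nf
  have hgrad : ∀ y, ‖gradient u y‖ ≤
      (N * (N + (Λ + 1) / 2) * Real.exp α * C) * Real.exp (-α * ‖y‖) := by
    intro y
    set P := C * Real.exp α * Real.exp (-α * ‖y‖) with hP
    have hP0 : 0 < P := by positivity
    have hM : ∀ x ∈ Metric.closedBall y 1, |u x| ≤ P := by
      intro x hx
      refine (hdecay x).trans ?_
      rw [hP, mul_assoc C (Real.exp α), ← Real.exp_add]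
      rw [mem_closedBall_iff_norm'] at hx
      have := norm_sub_norm_le y x
      exact mul_le_mul_of_nonneg_left (Real.exp_le_exp.2 (by nlinarith)) hC0.le
    have := norm_gradient_le_of_abs_le hu (M := P) (L := (Λ + 1) * P) y hM fun x hx => by
      rw [hlap, abs_neg]
      have h1 : (Λ : ℝ) * |u x| ≤ Λ * P := by gcongr; exact hM x hx
      linarith [hfΛ x]
    refine this.trans_eq ?_
    rw [hP]
    ring
  refine ⟨max C (N * (N + (Λ + 1) / 2) * Real.exp α * C), lt_max_of_lt_left hC0, α, hα0,
    fun x => ⟨(hdecay x).trans ?_, (hgrad x).trans ?_⟩⟩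
  · gcongr
    exact le_max_left _ _
  · gcongr
    exact le_max_right _ _
end

section
/- Let N ≥ 1 and let f : ℝ → ℝ be continuously differentiable with f(0) = 0, and suppose there exists δ > 0 such that f'(s) ≤ 0 for all s with |s| ≤ δ. If u : ℝ^N → ℝ is a classical solution of Δu + f(u) = 0 in ℝ^N, not identically zero, with u(x) → 0 as |x| → ∞, then u is unstable; more precisely, there exist R > 0 and a smooth function φ : ℝ^N → ℝ supported in the closed ball of radius R centered at the origin such that ∫_{ℝ^N} ( |∇φ(x)|² − f'(u(x)) φ(x)² ) dx < 0. -/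
open MeasureTheory Filter

section

open Set Metric Topology

section PartialDerivatives

variable {N : ℕ}

/-- The `i`-th partial derivative of a function on `ℝ^N`. -/
noncomputable def partialDeriv (i : Fin N) (φ : EuclideanSpace ℝ (Fin N) → ℝ)
    (x : EuclideanSpace ℝ (Fin N)) : ℝ :=
  fderiv ℝ φ x (EuclideanSpace.single i 1)

theorem coordLaplacian_eq_sum (φ : EuclideanSpace ℝ (Fin N) → ℝ) (x : EuclideanSpace ℝ (Fin N)) :
    coordLaplacian φ x = ∑ i, partialDeriv i (partialDeriv i φ) x := rfl

variable {φ ψ : EuclideanSpace ℝ (Fin N) → ℝ} {i : Fin N}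

theorem ContDiff.partialDeriv {m n : WithTop ℕ∞} (hφ : ContDiff ℝ n φ) (hmn : m + 1 ≤ n)
    (i : Fin N) : ContDiff ℝ m (partialDeriv i φ) :=
  (hφ.fderiv_right hmn).clm_apply contDiff_const

theorem ContDiff.continuous_partialDeriv (hφ : ContDiff ℝ 1 φ) (i : Fin N) :
    Continuous (_root_.partialDeriv i φ) :=
  (hφ.partialDeriv (m := 0) (by simp) i).continuous

theorem ContDiff.continuous_coordLaplacian (hφ : ContDiff ℝ 2 φ) :
    Continuous (coordLaplacian φ) :=
  continuous_finsetSum _ fun i _ =>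
    (hφ.partialDeriv (m := 1) (by norm_num) i).continuous_partialDeriv i

theorem HasCompactSupport.partialDeriv (hφ : HasCompactSupport φ) (i : Fin N) :
    HasCompactSupport (_root_.partialDeriv i φ) :=
  hφ.fderiv_apply (𝕜 := ℝ) _

theorem partialDeriv_add {x : EuclideanSpace ℝ (Fin N)} (hφ : DifferentiableAt ℝ φ x)
    (hψ : DifferentiableAt ℝ ψ x) :
    partialDeriv i (fun y => φ y + ψ y) x = partialDeriv i φ x + partialDeriv i ψ x := by
  simp [partialDeriv, fderiv_fun_add hφ hψ]

theorem partialDeriv_sub {x : EuclideanSpace ℝ (Fin N)} (hφ : DifferentiableAt ℝ φ x)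
    (hψ : DifferentiableAt ℝ ψ x) :
    partialDeriv i (fun y => φ y - ψ y) x = partialDeriv i φ x - partialDeriv i ψ x := by
  simp [partialDeriv, fderiv_fun_sub hφ hψ]

theorem partialDeriv_const_mul {x : EuclideanSpace ℝ (Fin N)} (hφ : DifferentiableAt ℝ φ x)
    (a : ℝ) : partialDeriv i (fun y => a * φ y) x = a * partialDeriv i φ x := by
  simp [partialDeriv, fderiv_const_mul hφ]

theorem partialDeriv_neg {x : EuclideanSpace ℝ (Fin N)} :
    partialDeriv i (fun y => -φ y) x = -partialDeriv i φ x := by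
  simp [partialDeriv, fderiv_fun_neg]

theorem partialDeriv_comp {g : ℝ → ℝ} {g' : ℝ} {x : EuclideanSpace ℝ (Fin N)}
    (hg : HasDerivAt g g' (φ x)) (hφ : DifferentiableAt ℝ φ x) :
    partialDeriv i (fun y => g (φ y)) x = g' * partialDeriv i φ x := by
  have := (hg.comp_hasFDerivAt x hφ.hasFDerivAt).fderiv
  rw [partialDeriv, show (fun y => g (φ y)) = g ∘ φ from rfl, this]
  simp [partialDeriv]

theorem hasDerivAt_line {x : EuclideanSpace ℝ (Fin N)} {t : ℝ}
    (hφ : DifferentiableAt ℝ φ (x + t • EuclideanSpace.single i 1)) :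
    HasDerivAt (fun s : ℝ => φ (x + s • EuclideanSpace.single i 1))
      (partialDeriv i φ (x + t • EuclideanSpace.single i 1)) t := by
  have h : HasDerivAt (fun s : ℝ => x + s • (EuclideanSpace.single i 1 : EuclideanSpace ℝ (Fin N)))
      (EuclideanSpace.single i 1) t := by
    simpa using ((hasDerivAt_id t).smul_const _).const_add x
  exact hφ.hasFDerivAt.comp_hasDerivAt t h

theorem norm_gradient_sq (φ : EuclideanSpace ℝ (Fin N) → ℝ) (x : EuclideanSpace ℝ (Fin N)) :
    ‖gradient φ x‖ ^ 2 = ∑ i, partialDeriv i φ x * partialDeriv i φ x := by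
  rw [EuclideanSpace.norm_sq_eq]
  refine Finset.sum_congr rfl fun i _ => ?_
  have : (gradient φ x) i = partialDeriv i φ x := by
    rw [partialDeriv, ← InnerProductSpace.toDual_symm_apply (𝕜 := ℝ)]
    rw [EuclideanSpace.inner_single_right]
    simp [gradient]
  rw [this, Real.norm_eq_abs, sq_abs, sq]

end PartialDerivatives

section LocalMin

theorem IsLocalMin.deriv_deriv_nonneg {h : ℝ → ℝ} {a : ℝ} (hmin : IsLocalMin h a)
    (hc : ContinuousAt h a) : 0 ≤ deriv (deriv h) a := by
  by_contra! hneg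
  have hmax := isLocalMax_of_deriv_deriv_neg hneg hmin.deriv_eq_zero hc
  have heq : h =ᶠ[𝓝 a] fun _ => h a := by
    filter_upwards [hmin, hmax] with y h1 h2 using le_antisymm h2 h1
  have := heq.deriv.deriv_eq
  simp at this
  exact hneg.ne this

theorem IsLocalMin.coordLaplacian_nonneg {N : ℕ} {w : EuclideanSpace ℝ (Fin N) → ℝ}
    {x : EuclideanSpace ℝ (Fin N)} (hmin : IsLocalMin w x) (hw : ContDiff ℝ 2 w) :
    0 ≤ coordLaplacian w x := by
  rw [coordLaplacian_eq_sum]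
  refine Finset.sum_nonneg fun i _ => ?_
  have hd : Differentiable ℝ w := hw.differentiable (by norm_num)
  have hd' : Differentiable ℝ (partialDeriv i w) :=
    (hw.partialDeriv (m := 1) (by norm_num) i).differentiable (by norm_num)
  have hline : Continuous fun t : ℝ =>
      x + t • (EuclideanSpace.single i 1 : EuclideanSpace ℝ (Fin N)) := by fun_prop
  have h1 : deriv (fun t : ℝ => w (x + t • EuclideanSpace.single i 1)) =
      fun t => partialDeriv i w (x + t • EuclideanSpace.single i 1) :=
    funext fun t => (hasDerivAt_line (hd _)).deriv
  have h2 := (hasDerivAt_line (x := x) (t := 0) (i := i) (hd' _)).deriv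
  rw [← h1] at h2
  rw [zero_smul, add_zero] at h2
  rw [← h2]
  refine IsLocalMin.deriv_deriv_nonneg ?_ (hw.continuous.comp hline).continuousAt
  have ht : Tendsto (fun t : ℝ => x + t • (EuclideanSpace.single i 1 : EuclideanSpace ℝ (Fin N)))
      (𝓝 0) (𝓝 x) := by simpa using hline.tendsto 0
  filter_upwards [ht.eventually hmin] with t h
  simpa using h

end LocalMin

section GradientEstimate

variable {N : ℕ}

theorem partialDeriv_comp_affine {φ : EuclideanSpace ℝ (Fin N) → ℝ} (hφ : Differentiable ℝ φ)
    (x : EuclideanSpace ℝ (Fin N))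
    (σ : EuclideanSpace ℝ (Fin N) →L[ℝ] EuclideanSpace ℝ (Fin N)) {j : Fin N} {s : ℝ}
    (hσ : σ (EuclideanSpace.single j 1) = s • EuclideanSpace.single j 1) :
    partialDeriv j (fun y => φ (x + σ y)) = fun y => s * partialDeriv j φ (x + σ y) := by
  ext y
  have h := (hφ (x + σ y)).hasFDerivAt.comp y (σ.hasFDerivAt.const_add x)
  have h' := h.fderiv
  rw [partialDeriv, show (fun y => φ (x + σ y)) = φ ∘ fun y => x + σ y from rfl, h']
  simp [hσ, partialDeriv]

theorem coordLaplacian_comp_affine {φ : EuclideanSpace ℝ (Fin N) → ℝ} (hφ : ContDiff ℝ 2 φ)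
    (x : EuclideanSpace ℝ (Fin N))
    (σ : EuclideanSpace ℝ (Fin N) →L[ℝ] EuclideanSpace ℝ (Fin N))
    (hσ : ∀ j, ∃ s : ℝ, s * s = 1 ∧
      σ (EuclideanSpace.single j 1) = s • EuclideanSpace.single j 1)
    (y : EuclideanSpace ℝ (Fin N)) :
    coordLaplacian (fun y => φ (x + σ y)) y = coordLaplacian φ (x + σ y) := by
  simp only [coordLaplacian_eq_sum]
  refine Finset.sum_congr rfl fun j _ => ?_
  obtain ⟨s, hs, hj⟩ := hσ j
  have hd : Differentiable ℝ (partialDeriv j φ) :=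
    (hφ.partialDeriv (m := 1) (by norm_num) j).differentiable (by norm_num)
  have hd2 : Differentiable ℝ fun y => partialDeriv j φ (x + σ y) :=
    hd.comp (σ.differentiable.const_add x)
  rw [partialDeriv_comp_affine (hφ.differentiable (by norm_num)) x σ hj,
    partialDeriv_const_mul (hd2 y), partialDeriv_comp_affine hd x σ hj, ← mul_assoc, hs, one_mul]

theorem exists_coordinate_reflection (i : Fin N) :
    ∃ σ : EuclideanSpace ℝ (Fin N) →L[ℝ] EuclideanSpace ℝ (Fin N),
      (∀ y, ‖σ y‖ = ‖y‖) ∧ (∀ y : EuclideanSpace ℝ (Fin N), y i = 0 → σ y = y) ∧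
      σ (EuclideanSpace.single i 1) = -EuclideanSpace.single i 1 ∧
      ∀ j, ∃ s : ℝ, s * s = 1 ∧
        σ (EuclideanSpace.single j 1) = s • EuclideanSpace.single j 1 := by
  set e : EuclideanSpace ℝ (Fin N) := EuclideanSpace.single i 1
  have hneg : (ℝ ∙ e)ᗮ.reflection e = -e :=
    Submodule.reflection_orthogonalComplement_singleton_eq_neg e
  have hfix : ∀ y : EuclideanSpace ℝ (Fin N), y i = 0 → (ℝ ∙ e)ᗮ.reflection y = y := fun y hy =>
    Submodule.reflection_mem_subspace_eq_self
      (by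
        rw [Submodule.mem_orthogonal_singleton_iff_inner_right]
        simp [e, EuclideanSpace.inner_single_left, hy])
  refine ⟨((ℝ ∙ e)ᗮ.reflection.toContinuousLinearEquiv : EuclideanSpace ℝ (Fin N) →L[ℝ] _),
    fun y => LinearIsometryEquiv.norm_map _ _, hfix, hneg, fun j => ?_⟩
  by_cases hj : j = i
  · subst hj
    exact ⟨-1, by norm_num, by simpa using hneg⟩
  · exact ⟨1, by norm_num, by simpa using hfix _ (by simp [Ne.symm hj])⟩

theorem partialDeriv_coord_sq (i j : Fin N) (x₀ : EuclideanSpace ℝ (Fin N)) :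
    partialDeriv j (fun y : EuclideanSpace ℝ (Fin N) => (y i - x₀ i) ^ 2) =
      fun y => if i = j then 2 * (y j - x₀ j) else 0 := by
  ext y
  have h1 : HasFDerivAt (fun y : EuclideanSpace ℝ (Fin N) => y i - x₀ i)
      (EuclideanSpace.proj i : EuclideanSpace ℝ (Fin N) →L[ℝ] ℝ) y :=
    (EuclideanSpace.proj (𝕜 := ℝ) i).hasFDerivAt.sub_const _
  rw [partialDeriv, (h1.pow 2).fderiv]
  by_cases h : i = j
  · subst h; simp
  · simp [h]

theorem partialDeriv_coord (i j : Fin N) :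
    partialDeriv j (fun y : EuclideanSpace ℝ (Fin N) => y i) =
      fun _ => if i = j then 1 else 0 := by
  ext y
  rw [partialDeriv]
  have h1 : HasFDerivAt (fun y : EuclideanSpace ℝ (Fin N) => y i)
      (EuclideanSpace.proj i : EuclideanSpace ℝ (Fin N) →L[ℝ] ℝ) y :=
    (EuclideanSpace.proj (𝕜 := ℝ) i).hasFDerivAt
  rw [h1.fderiv]
  simp

theorem partialDeriv_norm_sq (j : Fin N) (x₀ : EuclideanSpace ℝ (Fin N)) :
    partialDeriv j (fun y : EuclideanSpace ℝ (Fin N) => ‖y - x₀‖ ^ 2) =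
      fun y => 2 * (y j - x₀ j) := by
  ext y
  have h := ((hasFDerivAt_id y).sub_const x₀).norm_sq.fderiv
  rw [partialDeriv]
  simp only [id] at h
  rw [h]
  simp [EuclideanSpace.inner_single_right]

theorem partialDeriv_const {i : Fin N} (a : ℝ) :
    partialDeriv i (fun _ : EuclideanSpace ℝ (Fin N) => a) = fun _ => 0 := by
  ext; simp [partialDeriv]

theorem coordLaplacian_sub {φ ψ : EuclideanSpace ℝ (Fin N) → ℝ} (hφ : ContDiff ℝ 2 φ)
    (hψ : ContDiff ℝ 2 ψ) (x : EuclideanSpace ℝ (Fin N)) :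
    coordLaplacian (fun y => φ y - ψ y) x = coordLaplacian φ x - coordLaplacian ψ x := by
  simp only [coordLaplacian_eq_sum, ← Finset.sum_sub_distrib]
  refine Finset.sum_congr rfl fun j _ => ?_
  have h1 : Differentiable ℝ (partialDeriv j φ) :=
    (hφ.partialDeriv (m := 1) (by norm_num) j).differentiable (by norm_num)
  have h2 : Differentiable ℝ (partialDeriv j ψ) :=
    (hψ.partialDeriv (m := 1) (by norm_num) j).differentiable (by norm_num)
  have h : partialDeriv j (fun y => φ y - ψ y) =
      fun y => partialDeriv j φ y - partialDeriv j ψ y :=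
    funext fun y => partialDeriv_sub (hφ.differentiable (by norm_num) y)
      (hψ.differentiable (by norm_num) y)
  rw [h, partialDeriv_sub (h1 x) (h2 x)]

theorem coordLaplacian_add {φ ψ : EuclideanSpace ℝ (Fin N) → ℝ} (hφ : ContDiff ℝ 2 φ)
    (hψ : ContDiff ℝ 2 ψ) (x : EuclideanSpace ℝ (Fin N)) :
    coordLaplacian (fun y => φ y + ψ y) x = coordLaplacian φ x + coordLaplacian ψ x := by
  simp only [coordLaplacian_eq_sum, ← Finset.sum_add_distrib]
  refine Finset.sum_congr rfl fun j _ => ?_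
  have h1 : Differentiable ℝ (partialDeriv j φ) :=
    (hφ.partialDeriv (m := 1) (by norm_num) j).differentiable (by norm_num)
  have h2 : Differentiable ℝ (partialDeriv j ψ) :=
    (hψ.partialDeriv (m := 1) (by norm_num) j).differentiable (by norm_num)
  have h : partialDeriv j (fun y => φ y + ψ y) =
      fun y => partialDeriv j φ y + partialDeriv j ψ y :=
    funext fun y => partialDeriv_add (hφ.differentiable (by norm_num) y)
      (hψ.differentiable (by norm_num) y)
  rw [h, partialDeriv_add (h1 x) (h2 x)]

theorem coordLaplacian_const_mul {φ : EuclideanSpace ℝ (Fin N) → ℝ} (hφ : ContDiff ℝ 2 φ)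
    (a : ℝ) (x : EuclideanSpace ℝ (Fin N)) :
    coordLaplacian (fun y => a * φ y) x = a * coordLaplacian φ x := by
  simp only [coordLaplacian_eq_sum, Finset.mul_sum]
  refine Finset.sum_congr rfl fun j _ => ?_
  have h1 : Differentiable ℝ (partialDeriv j φ) :=
    (hφ.partialDeriv (m := 1) (by norm_num) j).differentiable (by norm_num)
  rw [funext fun y => partialDeriv_const_mul (i := j) (hφ.differentiable (by norm_num) y) a,
    partialDeriv_const_mul (h1 x)]

theorem coordLaplacian_norm_sq (x : EuclideanSpace ℝ (Fin N)) :
    coordLaplacian (fun y : EuclideanSpace ℝ (Fin N) => ‖y‖ ^ 2) x = 2 * N := by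
  have h : ∀ j : Fin N, partialDeriv j (partialDeriv j
      (fun y : EuclideanSpace ℝ (Fin N) => ‖y‖ ^ 2)) x = 2 := by
    intro j
    have := partialDeriv_norm_sq j 0
    simp only [sub_zero, PiLp.zero_apply] at this
    rw [this, partialDeriv_const_mul (by fun_prop), partialDeriv_coord]
    simp
  simp [coordLaplacian_eq_sum, h, mul_comm]

theorem coordLaplacian_coord_sub_sq (i : Fin N) (x : EuclideanSpace ℝ (Fin N)) :
    coordLaplacian (fun y : EuclideanSpace ℝ (Fin N) => y i - (y i) ^ 2) x = -2 := by
  have h : ∀ j : Fin N, partialDeriv j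
      (fun y : EuclideanSpace ℝ (Fin N) => y i - (y i) ^ 2) =
      fun y => if i = j then 1 - 2 * y j else 0 := by
    intro j
    ext y
    have h2 := congrFun (partialDeriv_coord_sq i j 0) y
    simp only [PiLp.zero_apply, sub_zero] at h2
    rw [partialDeriv_sub (by fun_prop) (by fun_prop), partialDeriv_coord, h2]
    split_ifs <;> simp
  rw [coordLaplacian_eq_sum, Finset.sum_eq_single i]
  · rw [h]
    simp only [if_true]
    rw [partialDeriv_sub (by fun_prop) (by fun_prop), partialDeriv_const,
      partialDeriv_const_mul (by fun_prop), partialDeriv_coord]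
    simp
  · intro j _ hj
    rw [h]
    simp [hj.symm, partialDeriv_const]
  · simp

/-- Interior gradient estimate, by comparison of the odd part of `u` with a quadratic barrier on a
half ball. -/
theorem partialDeriv_le_of_bound {u : EuclideanSpace ℝ (Fin N) → ℝ} (hu : ContDiff ℝ 2 u)
    {x : EuclideanSpace ℝ (Fin N)} {S F : ℝ} (hS : ∀ y ∈ closedBall x 1, |u y| ≤ S)
    (hF : ∀ y ∈ closedBall x 1, |coordLaplacian u y| ≤ F) (i : Fin N) :
    partialDeriv i u x ≤ N * S + F := by
  refine le_of_forall_pos_le_add fun η hη => ?_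
  have hS0 : 0 ≤ S := (abs_nonneg _).trans (hS x (mem_closedBall_self zero_le_one))
  have hF0 : 0 ≤ F := (abs_nonneg _).trans (hF x (mem_closedBall_self zero_le_one))
  obtain ⟨σ, hσn, hσfix, hσi, hσ⟩ := exists_coordinate_reflection i
  set a : ℝ := N * S + F + η with ha
  have ha0 : 0 ≤ a := by positivity
  have hu1 : Differentiable ℝ u := hu.differentiable (by norm_num)
  set τ : EuclideanSpace ℝ (Fin N) →L[ℝ] EuclideanSpace ℝ (Fin N) := ContinuousLinearMap.id ℝ _
  have hτ : ∀ j, ∃ s : ℝ, s * s = 1 ∧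
      τ (EuclideanSpace.single j 1) = s • EuclideanSpace.single j 1 :=
    fun j => ⟨1, by norm_num, by simp [τ]⟩
  set W : EuclideanSpace ℝ (Fin N) → ℝ := fun y =>
    (S * ‖y‖ ^ 2 + a * (y i - (y i) ^ 2)) - ((1 / 2) * u (x + τ y) - (1 / 2) * u (x + σ y)) with hW
  have hc1 : ContDiff ℝ 2 fun y : EuclideanSpace ℝ (Fin N) => ‖y‖ ^ 2 := contDiff_norm_sq ℝ
  have hc2 : ContDiff ℝ 2 fun y : EuclideanSpace ℝ (Fin N) => y i - (y i) ^ 2 := by fun_prop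
  have hc3 : ContDiff ℝ 2 fun y : EuclideanSpace ℝ (Fin N) => u (x + τ y) := by fun_prop
  have hc4 : ContDiff ℝ 2 fun y : EuclideanSpace ℝ (Fin N) => u (x + σ y) := by fun_prop
  have hWc : ContDiff ℝ 2 W := by
    refine ContDiff.sub (ContDiff.add ?_ ?_) (ContDiff.sub ?_ ?_) <;>
      exact contDiff_const.mul (by assumption)
  have hball : ∀ y : EuclideanSpace ℝ (Fin N), ‖y‖ ≤ 1 →
      x + τ y ∈ closedBall x 1 ∧ x + σ y ∈ closedBall x 1 := by
    intro y hy
    simp [mem_closedBall, dist_eq_norm, hσn, τ, hy]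
  have hWL : ∀ y : EuclideanSpace ℝ (Fin N), ‖y‖ ≤ 1 → coordLaplacian W y < 0 := by
    intro y hy
    have h1 := abs_le.1 (hF _ (hball y hy).1)
    have h2 := abs_le.1 (hF _ (hball y hy).2)
    rw [hW, coordLaplacian_sub (by fun_prop) (by fun_prop), coordLaplacian_add (by fun_prop)
      (by fun_prop), coordLaplacian_sub (by fun_prop) (by fun_prop),
      coordLaplacian_const_mul hc1, coordLaplacian_const_mul hc2, coordLaplacian_const_mul hc3,
      coordLaplacian_const_mul hc4, coordLaplacian_norm_sq, coordLaplacian_coord_sub_sq,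
      coordLaplacian_comp_affine hu x τ hτ, coordLaplacian_comp_affine hu x σ hσ]
    linarith
  set D : Set (EuclideanSpace ℝ (Fin N)) := closedBall 0 1 ∩ {y | 0 ≤ y i} with hD
  have hDc : IsCompact D :=
    (isCompact_closedBall _ _).inter_right (isClosed_le continuous_const (by fun_prop))
  have hcoord : ∀ y : EuclideanSpace ℝ (Fin N), |y i| ≤ ‖y‖ := fun y => PiLp.norm_apply_le y i
  have hWD : ∀ y ∈ D, 0 ≤ W y := by
    obtain ⟨z, hzD, hz⟩ := hDc.exists_isMinOn ⟨0, by simp [hD]⟩ hWc.continuous.continuousOn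
    intro y hy
    refine le_trans ?_ (hz hy)
    by_contra! hneg
    obtain ⟨hz1, hz2⟩ := hzD
    have hz1' : ‖z‖ ≤ 1 := by simpa using hz1
    have hzi : z i ≤ 1 := (le_abs_self _).trans ((hcoord z).trans hz1')
    have hz2' : (0 : ℝ) ≤ z i := hz2
    have hp : 0 ≤ a * (z i - z i ^ 2) := mul_nonneg ha0 (by nlinarith)
    have hz0 : 0 < z i := by
      refine lt_of_le_of_ne hz2' fun h => hneg.not_ge ?_
      have : σ z = z := hσfix z h.symm
      simp only [hW, this, ← h, τ, ContinuousLinearMap.id_apply]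
      have := mul_nonneg hS0 (sq_nonneg ‖z‖)
      linarith
    have hzlt : ‖z‖ < 1 := by
      refine lt_of_le_of_ne hz1' fun h => hneg.not_ge ?_
      have h1 := abs_le.1 (hS _ (hball z hz1').1)
      have h2 := abs_le.1 (hS _ (hball z hz1').2)
      simp only [hW, h]
      linarith
    have hnhds : D ∈ 𝓝 z := by
      refine Filter.inter_mem (closedBall_mem_nhds_of_mem (by simpa using hzlt)) ?_
      exact Filter.mem_of_superset ((isOpen_lt continuous_const
        (by fun_prop : Continuous fun y : EuclideanSpace ℝ (Fin N) => y i)).mem_nhds hz0)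
        fun y (hy : 0 < y i) => hy.le
    exact (hWL z hz1').not_ge ((hz.isLocalMin hnhds).coordLaplacian_nonneg hWc)
  have hWd : HasDerivAt (fun t : ℝ => W (0 + t • EuclideanSpace.single i 1))
      (partialDeriv i W (0 + (0 : ℝ) • EuclideanSpace.single i 1)) 0 :=
    hasDerivAt_line ((hWc.differentiable (by norm_num)) _)
  simp only [zero_add, zero_smul] at hWd
  have hder : partialDeriv i W 0 = a - partialDeriv i u x := by
    have hsq := congrFun (partialDeriv_coord_sq i i 0) 0
    have hns := congrFun (partialDeriv_norm_sq i 0) 0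
    simp only [PiLp.zero_apply, sub_zero, mul_zero, if_true] at hsq hns
    have hd1 : DifferentiableAt ℝ (fun y : EuclideanSpace ℝ (Fin N) => ‖y‖ ^ 2) 0 :=
      hc1.differentiable (by norm_num) 0
    have hd2 := hd1.const_mul S
    have hd3 : DifferentiableAt ℝ (fun y : EuclideanSpace ℝ (Fin N) =>
        S * ‖y‖ ^ 2 + a * (y i - (y i) ^ 2)) 0 := hd2.fun_add (by fun_prop)
    rw [hW, partialDeriv_sub hd3 (by fun_prop),
      partialDeriv_add hd2 (by fun_prop), partialDeriv_sub (by fun_prop) (by fun_prop),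
      partialDeriv_const_mul hd1, partialDeriv_const_mul (by fun_prop),
      partialDeriv_const_mul (by fun_prop), partialDeriv_const_mul (by fun_prop),
      partialDeriv_sub (by fun_prop) (by fun_prop), partialDeriv_coord, hsq, hns,
      partialDeriv_comp_affine hu1 x τ (s := 1) (by simp [τ]),
      partialDeriv_comp_affine hu1 x σ (s := -1) (by simp [hσi])]
    simp
    ring
  have hnonneg : 0 ≤ partialDeriv i W 0 := by
    have hslope := hWd.tendsto_slope.mono_left (nhdsWithin_mono (0 : ℝ)
      (fun t (ht : t ∈ Ioi (0 : ℝ)) => (ne_of_gt ht : t ≠ 0)))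
    refine ge_of_tendsto hslope ?_
    filter_upwards [Ioo_mem_nhdsGT (zero_lt_one' ℝ)] with t ht
    have hmem : t • EuclideanSpace.single i (1 : ℝ) ∈ D := by
      refine ⟨?_, ?_⟩
      · simp [norm_smul, abs_of_pos ht.1, ht.2.le]
      · simp [ht.1.le]
    have hW0 : W 0 = 0 := by simp [hW]
    rw [slope_def_field]
    simp only [zero_smul, hW0, sub_zero]
    exact div_nonneg (hWD _ hmem) ht.1.le
  rw [hder] at hnonneg
  linarith

theorem abs_partialDeriv_le_of_bound {u : EuclideanSpace ℝ (Fin N) → ℝ} (hu : ContDiff ℝ 2 u)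
    {x : EuclideanSpace ℝ (Fin N)} {S F : ℝ} (hS : ∀ y ∈ closedBall x 1, |u y| ≤ S)
    (hF : ∀ y ∈ closedBall x 1, |coordLaplacian u y| ≤ F) (i : Fin N) :
    |partialDeriv i u x| ≤ N * S + F := by
  refine abs_le'.2 ⟨partialDeriv_le_of_bound hu hS hF i, ?_⟩
  rw [← partialDeriv_neg]
  refine partialDeriv_le_of_bound hu.neg (by simpa using hS) (fun y hy => ?_) i
  have h := coordLaplacian_const_mul hu (-1) y
  simp only [neg_one_mul] at h
  rw [h, abs_neg]
  exact hF y hy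

theorem tendsto_partialDeriv_cocompact {u : EuclideanSpace ℝ (Fin N) → ℝ} (hu : ContDiff ℝ 2 u)
    (h0 : Tendsto u (cocompact _) (𝓝 0)) (hL : Tendsto (coordLaplacian u) (cocompact _) (𝓝 0))
    (i : Fin N) : Tendsto (partialDeriv i u) (cocompact _) (𝓝 0) := by
  rw [Metric.tendsto_nhds]
  intro ε hε
  have hη : 0 < ε / (N + 2) := by positivity
  have h1 := ((Metric.tendsto_nhds.1 h0 _ hη).and (Metric.tendsto_nhds.1 hL _ hη))
  rw [← Metric.cobounded_eq_cocompact] at h1 ⊢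
  obtain ⟨ρ, -, hρ⟩ := (Metric.hasBasis_cobounded_compl_closedBall
    (0 : EuclideanSpace ℝ (Fin N))).eventually_iff.1 h1
  refine (Metric.hasBasis_cobounded_compl_closedBall
    (0 : EuclideanSpace ℝ (Fin N))).eventually_iff.2 ⟨ρ + 1, trivial, fun x hx => ?_⟩
  have hfar : ∀ y ∈ closedBall x 1, y ∈ (closedBall (0 : EuclideanSpace ℝ (Fin N)) ρ)ᶜ := by
    intro y hy
    simp only [mem_compl_iff, mem_closedBall, not_le] at hx hy ⊢
    have := dist_triangle x y 0
    rw [dist_comm] at hy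
    linarith
  have h := abs_partialDeriv_le_of_bound hu (x := x) (S := ε / (N + 2)) (F := ε / (N + 2))
    (fun y hy => by simpa using (hρ (hfar y hy)).1.le)
    (fun y hy => by simpa using (hρ (hfar y hy)).2.le) i
  rw [Real.dist_0_eq_abs]
  refine h.trans_lt ?_
  have : (N : ℝ) * (ε / (N + 2)) + ε / (N + 2) = ε - ε / (N + 2) := by field_simp; ring
  linarith

end GradientEstimate

section EnergyForm

variable {N : ℕ}

/-- The bilinear form `∫ ∇φ · ∇ψ - c φ ψ` of the Schrödinger operator `-Δ - c`. -/
noncomputable def energyForm (c φ ψ : EuclideanSpace ℝ (Fin N) → ℝ) : ℝ :=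
  ∫ x, (∑ i, partialDeriv i φ x * partialDeriv i ψ x - c x * φ x * ψ x)

variable {c φ ψ : EuclideanSpace ℝ (Fin N) → ℝ}

theorem energyForm_comm : energyForm c φ ψ = energyForm c ψ φ := by
  simp only [energyForm]
  refine integral_congr_ae (Eventually.of_forall fun x => ?_)
  simp only [mul_comm (partialDeriv _ φ x)]
  ring

theorem HasCompactSupport.integrable_mul_right {a b : EuclideanSpace ℝ (Fin N) → ℝ}
    (ha : Continuous a) (hb : Continuous b) (hc : HasCompactSupport b) :
    Integrable fun x => a x * b x :=
  (ha.mul hb).integrable_of_hasCompactSupport (hc.mul_left (f := a))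

theorem integrable_energyForm (hc : Continuous c) (hφ : ContDiff ℝ 1 φ) (hψ : ContDiff ℝ 1 ψ)
    (hs : HasCompactSupport ψ) :
    Integrable fun x => ∑ i, partialDeriv i φ x * partialDeriv i ψ x - c x * φ x * ψ x :=
  (integrable_finsetSum _ fun i _ => (hs.partialDeriv i).integrable_mul_right
    (hφ.continuous_partialDeriv i) (hψ.continuous_partialDeriv i)).sub
    (hs.integrable_mul_right (hc.mul hφ.continuous) hψ.continuous)

theorem energyForm_add_const_mul_self (hc : Continuous c) (hφ : ContDiff ℝ 1 φ)
    (hψ : ContDiff ℝ 1 ψ) (hsφ : HasCompactSupport φ) (hsψ : HasCompactSupport ψ) (t : ℝ) :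
    energyForm c (fun x => φ x + t * ψ x) (fun x => φ x + t * ψ x) =
      energyForm c φ φ + 2 * t * energyForm c φ ψ + t ^ 2 * energyForm c ψ ψ := by
  have h1 := integrable_energyForm hc hφ hφ hsφ
  have h2 := integrable_energyForm hc hφ hψ hsψ
  have h3 := integrable_energyForm hc hψ hψ hsψ
  simp only [energyForm]
  rw [← integral_const_mul, ← integral_const_mul, ← integral_add h1 (h2.const_mul _),
    ← integral_add (h1.fun_add (h2.const_mul _)) (h3.const_mul _)]
  refine integral_congr_ae (Eventually.of_forall fun x => ?_)
  have hp : ∀ i, partialDeriv i (fun x => φ x + t * ψ x) x =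
      partialDeriv i φ x + t * partialDeriv i ψ x := fun i => by
    have hψ' := hψ.differentiable (by norm_num) x
    rw [partialDeriv_add (hφ.differentiable (by norm_num) x) (hψ'.const_mul t),
      partialDeriv_const_mul hψ']
  have hsum : ∑ i, (partialDeriv i φ x + t * partialDeriv i ψ x) *
      (partialDeriv i φ x + t * partialDeriv i ψ x) =
      ∑ i, partialDeriv i φ x * partialDeriv i φ x +
        2 * t * ∑ i, partialDeriv i φ x * partialDeriv i ψ x +
        t ^ 2 * ∑ i, partialDeriv i ψ x * partialDeriv i ψ x := by
    simp only [Finset.mul_sum, ← Finset.sum_add_distrib]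
    exact Finset.sum_congr rfl fun i _ => by ring
  simp only [hp, hsum]
  ring

/-- Green's first identity. -/
theorem integral_sum_partialDeriv_mul (hφ : ContDiff ℝ 2 φ) (hψ : ContDiff ℝ 1 ψ)
    (hs : HasCompactSupport ψ) :
    ∫ x, ∑ i, partialDeriv i φ x * partialDeriv i ψ x = -∫ x, coordLaplacian φ x * ψ x := by
  have hφ' : ∀ i, ContDiff ℝ 1 (partialDeriv i φ) := fun i => hφ.partialDeriv (by norm_num) i
  have hint1 : ∀ i : Fin N, Integrable fun x => partialDeriv i φ x * partialDeriv i ψ x :=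
    fun i => (hs.partialDeriv i).integrable_mul_right (hφ' i).continuous
      (hψ.continuous_partialDeriv i)
  have hint2 : ∀ i : Fin N, Integrable fun x => partialDeriv i (partialDeriv i φ) x * ψ x :=
    fun i => hs.integrable_mul_right ((hφ' i).continuous_partialDeriv i) hψ.continuous
  simp only [coordLaplacian_eq_sum, Finset.sum_mul]
  rw [integral_finsetSum _ fun i _ => hint1 i, integral_finsetSum _ fun i _ => hint2 i,
    ← Finset.sum_neg_distrib]
  refine Finset.sum_congr rfl fun i _ => ?_
  exact integral_mul_fderiv_eq_neg_fderiv_mul_of_integrable (hint2 i) (hint1 i)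
    (hs.integrable_mul_right (hφ' i).continuous hψ.continuous)
    (fun x _ => (hφ' i).differentiable (by norm_num) x)
    (fun x _ => hψ.differentiable (by norm_num) x)

theorem energyForm_eq_neg_integral (hc : Continuous c) (hφ : ContDiff ℝ 2 φ)
    (hψ : ContDiff ℝ 1 ψ) (hs : HasCompactSupport ψ) :
    energyForm c φ ψ = -∫ x, (coordLaplacian φ x + c x * φ x) * ψ x := by
  have hφ1 : ContDiff ℝ 1 φ := hφ.of_le (by norm_num)
  have h1 : Integrable fun x => ∑ i, partialDeriv i φ x * partialDeriv i ψ x :=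
    integrable_finsetSum _ fun i _ => (hs.partialDeriv i).integrable_mul_right
      (hφ1.continuous_partialDeriv i) (hψ.continuous_partialDeriv i)
  have h2 : Integrable fun x => c x * φ x * ψ x :=
    hs.integrable_mul_right (hc.mul hφ.continuous) hψ.continuous
  have h3 := hs.integrable_mul_right hφ.continuous_coordLaplacian hψ.continuous
  simp only [energyForm, add_mul]
  rw [integral_sub h1 h2, integral_add h3 h2, integral_sum_partialDeriv_mul hφ hψ hs]
  ring

theorem hasDerivAt_integral_translate (hφ : ContDiff ℝ 1 φ) (hψ : Continuous ψ)
    (hs : HasCompactSupport ψ) (i : Fin N) :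
    HasDerivAt (fun t : ℝ => ∫ x, φ (x + t • EuclideanSpace.single i 1) * ψ x)
      (∫ x, partialDeriv i φ x * ψ x) 0 := by
  obtain ⟨ρ, hρ⟩ := hs.isCompact.isBounded.subset_closedBall 0
  obtain ⟨C, hC⟩ := (isCompact_closedBall (0 : EuclideanSpace ℝ (Fin N))
    (ρ + 1)).exists_bound_of_continuousOn (hφ.continuous_partialDeriv i).continuousOn
  have hcont : ∀ t : ℝ, Continuous fun x : EuclideanSpace ℝ (Fin N) =>
      φ (x + t • EuclideanSpace.single i 1) * ψ x := fun t =>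
    (hφ.continuous.comp (by fun_prop)).mul hψ
  have key := hasDerivAt_integral_of_dominated_loc_of_deriv_le (μ := volume) (x₀ := (0 : ℝ))
    (F := fun (t : ℝ) x => φ (x + t • EuclideanSpace.single i 1) * ψ x)
    (F' := fun (t : ℝ) x => partialDeriv i φ (x + t • EuclideanSpace.single i 1) * ψ x)
    (bound := fun x => C * |ψ x|) (ball_mem_nhds _ one_pos)
    (Eventually.of_forall fun t => (hcont t).aestronglyMeasurable)
    ((hcont 0).integrable_of_hasCompactSupport hs.mul_left)
    (((hφ.continuous_partialDeriv i).comp (by fun_prop)).mul hψ).aestronglyMeasurable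
    (Eventually.of_forall fun x t ht => ?_)
    ((continuous_const.mul hψ.abs).integrable_of_hasCompactSupport
      (hs.norm.mul_left (f := fun _ => C)))
    (Eventually.of_forall fun x t _ =>
      (hasDerivAt_line (hφ.differentiable (by norm_num) _)).mul_const _)
  · simpa using key.2
  · rw [norm_mul, Real.norm_eq_abs (ψ x)]
    by_cases hx : ψ x = 0
    · simp [hx]
    refine mul_le_mul_of_nonneg_right (hC _ ?_) (abs_nonneg _)
    have h1 : ‖x‖ ≤ ρ := by simpa using hρ (subset_tsupport _ hx)
    have h2 : |t| < 1 := by simpa using ht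
    rw [mem_closedBall_zero_iff]
    refine (norm_add_le _ _).trans ?_
    simp only [norm_smul, Real.norm_eq_abs, PiLp.norm_single, norm_one, mul_one]
    linarith

/-- The partial derivatives of a solution solve the linearized equation weakly. -/
theorem energyForm_partialDeriv_eq_zero {f : ℝ → ℝ} (hf : ContDiff ℝ 1 f)
    {u : EuclideanSpace ℝ (Fin N) → ℝ} (hu : ContDiff ℝ 2 u)
    (heq : ∀ x, coordLaplacian u x + f (u x) = 0) (i : Fin N) (hψ : ContDiff ℝ 1 ψ)
    (hs : HasCompactSupport ψ) :
    energyForm (fun x => deriv f (u x)) (partialDeriv i u) ψ = 0 := by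
  have hu1 : ContDiff ℝ 1 u := hu.of_le (by norm_num)
  have hu' : ∀ j, ContDiff ℝ 1 (partialDeriv j u) := fun j => hu.partialDeriv (by norm_num) j
  have hfu : ContDiff ℝ 1 fun x => f (u x) := hf.comp hu1
  have hder := (HasDerivAt.fun_sum (u := Finset.univ) fun j _ =>
    hasDerivAt_integral_translate (hu' j) (hψ.continuous_partialDeriv j)
    (hs.partialDeriv j) i).fun_sub (hasDerivAt_integral_translate hfu hψ.continuous hs i)
  have hzero : ∀ t : ℝ, (∑ j, ∫ x, partialDeriv j u (x + t • EuclideanSpace.single i 1) *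
      partialDeriv j ψ x) - ∫ x, f (u (x + t • EuclideanSpace.single i 1)) * ψ x = 0 := by
    intro t
    set p : EuclideanSpace ℝ (Fin N) := t • EuclideanSpace.single i 1
    set τ : EuclideanSpace ℝ (Fin N) →L[ℝ] EuclideanSpace ℝ (Fin N) := ContinuousLinearMap.id ℝ _
    have hcomp : ContDiff ℝ 2 fun y => u (p + τ y) := by fun_prop
    have hg := integral_sum_partialDeriv_mul hcomp hψ hs
    rw [integral_finsetSum _ fun j _ => (hs.partialDeriv j).integrable_mul_right
      ((hcomp.of_le (by norm_num)).continuous_partialDeriv j) (hψ.continuous_partialDeriv j)] at hg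
    have hpd : ∀ j, partialDeriv j (fun y => u (p + τ y)) = fun y => partialDeriv j u (y + p) := by
      intro j
      rw [partialDeriv_comp_affine (hu.differentiable (by norm_num)) p τ (s := 1) (by simp [τ])]
      ext y
      simp [τ, add_comm]
    have hlap : ∀ y, coordLaplacian (fun y => u (p + τ y)) y = -f (u (y + p)) := by
      intro y
      rw [coordLaplacian_comp_affine hu p τ fun j => ⟨1, by norm_num, by simp [τ]⟩]
      have := heq (y + p)
      simp only [τ, ContinuousLinearMap.id_apply, add_comm p]
      linarith
    simp only [hpd, hlap, neg_mul, integral_neg, neg_neg] at hg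
    rw [hg, sub_self]
  simp only [hzero] at hder
  have hval := hder.unique (hasDerivAt_const _ _)
  have hcd : Continuous fun x => deriv f (u x) :=
    (hf.continuous_deriv (by norm_num)).comp hu.continuous
  have hint1 : ∀ j : Fin N, Integrable fun x =>
      partialDeriv j (partialDeriv i u) x * partialDeriv j ψ x := fun j =>
    (hs.partialDeriv j).integrable_mul_right ((hu' i).continuous_partialDeriv j)
      (hψ.continuous_partialDeriv j)
  have hint2 : Integrable fun x => deriv f (u x) * partialDeriv i u x * ψ x :=
    hs.integrable_mul_right (hcd.mul (hu' i).continuous) hψ.continuous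
  have hsymm : ∀ j : Fin N, partialDeriv i (partialDeriv j u) =
      partialDeriv j (partialDeriv i u) := by
    intro j
    ext x
    have h2 : DifferentiableAt ℝ (fderiv ℝ u) x :=
      (hu.fderiv_right (m := 1) (by norm_num)).differentiable (by norm_num) x
    have hpd : ∀ k l : Fin N, partialDeriv k (partialDeriv l u) x =
        fderiv ℝ (fderiv ℝ u) x (EuclideanSpace.single k 1) (EuclideanSpace.single l 1) := by
      intro k l
      change fderiv ℝ (fun y => fderiv ℝ u y (EuclideanSpace.single l 1)) x _ = _
      rw [fderiv_clm_apply h2 (differentiableAt_const _)]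
      simp
    rw [hpd, hpd]
    exact (hu.contDiffAt.isSymmSndFDerivAt (by simp)).eq _ _
  have hchain : ∀ x, partialDeriv i (fun x => f (u x)) x = deriv f (u x) * partialDeriv i u x :=
    fun x => partialDeriv_comp (hf.differentiable (by norm_num) _).hasDerivAt
      (hu.differentiable (by norm_num) x)
  simp only [energyForm]
  rw [integral_sub (integrable_finsetSum _ fun j _ => hint1 j) hint2,
    integral_finsetSum _ fun j _ => hint1 j]
  simpa only [hsymm, hchain] using hval

end EnergyForm

section Mollification

variable {N : ℕ}

theorem norm_normed_convolution_le (k : ContDiffBump (0 : EuclideanSpace ℝ (Fin N)))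
    {g : EuclideanSpace ℝ (Fin N) → ℝ} (hg : Continuous g) {M : ℝ} (hM : ∀ x, |g x| ≤ M)
    (x : EuclideanSpace ℝ (Fin N)) :
    |convolution (k.normed volume) g (ContinuousLinearMap.lsmul ℝ ℝ) volume x| ≤ 3 * M := by
  have h := k.dist_normed_convolution_le (μ := volume) (x₀ := x) (ε := 2 * M)
    hg.aestronglyMeasurable fun y _ => by
      rw [Real.dist_eq]
      linarith [abs_sub (g y) (g x), hM x, hM y]
  rw [Real.dist_eq] at h
  have h' := abs_add_le (convolution (k.normed volume) g (ContinuousLinearMap.lsmul ℝ ℝ) volume x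
    - g x) (g x)
  rw [sub_add_cancel] at h'
  linarith [hM x]

theorem partialDeriv_convolution (k : ContDiffBump (0 : EuclideanSpace ℝ (Fin N)))
    {φ : EuclideanSpace ℝ (Fin N) → ℝ} (hφ : ContDiff ℝ 1 φ) (hs : HasCompactSupport φ)
    (i : Fin N) (x : EuclideanSpace ℝ (Fin N)) :
    partialDeriv i (convolution (k.normed volume) φ (ContinuousLinearMap.lsmul ℝ ℝ) volume) x =
      convolution (k.normed volume) (partialDeriv i φ) (ContinuousLinearMap.lsmul ℝ ℝ) volume
        x := by
  have hk : LocallyIntegrable (k.normed volume) volume := k.continuous_normed.locallyIntegrable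
  rw [partialDeriv, (hs.hasFDerivAt_convolution_right _ hk hφ x).fderiv,
    convolution_precompR_apply _ hk (hs.fderiv ℝ) (hφ.continuous_fderiv (by norm_num))]
  rfl

theorem HasCompactSupport.exists_bound_abs {φ : EuclideanSpace ℝ (Fin N) → ℝ}
    (hs : HasCompactSupport φ) (hφ : Continuous φ) : ∃ M, 0 ≤ M ∧ ∀ x, |φ x| ≤ M := by
  obtain ⟨M, hM⟩ := hφ.bounded_above_of_compact_support hs
  exact ⟨M, (norm_nonneg _).trans (hM 0), hM⟩

/-- Nonnegativity of the quadratic form passes from smooth to `C¹` test functions. -/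
theorem energyForm_nonneg_of_smooth {c : EuclideanSpace ℝ (Fin N) → ℝ} (hc : Continuous c)
    (hst : ∀ φ, ContDiff ℝ (⊤ : ℕ∞) φ → HasCompactSupport φ → 0 ≤ energyForm c φ φ)
    {φ : EuclideanSpace ℝ (Fin N) → ℝ} (hφ : ContDiff ℝ 1 φ) (hs : HasCompactSupport φ) :
    0 ≤ energyForm c φ φ := by
  let k : ℕ → ContDiffBump (0 : EuclideanSpace ℝ (Fin N)) := fun n =>
    ⟨1 / (2 * (n + 1)), 1 / (n + 1), by positivity, by
      apply one_div_lt_one_div_of_lt <;> linarith [n.cast_nonneg (α := ℝ)]⟩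
  have hk : Tendsto (fun n => (k n).rOut) atTop (𝓝 0) := tendsto_one_div_add_atTop_nhds_zero_nat
  have hk1 : ∀ n, (k n).rOut ≤ 1 := fun n => by
    change (1 : ℝ) / (n + 1) ≤ 1
    rw [div_le_one (by positivity)]
    linarith [n.cast_nonneg (α := ℝ)]
  let Φ : ℕ → EuclideanSpace ℝ (Fin N) → ℝ := fun n =>
    convolution ((k n).normed volume) φ (ContinuousLinearMap.lsmul ℝ ℝ) volume
  have hΦsmooth : ∀ n, ContDiff ℝ (⊤ : ℕ∞) (Φ n) := fun n =>
    HasCompactSupport.contDiff_convolution_left _ (k n).hasCompactSupport_normed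
      (k n).contDiff_normed hφ.continuous.locallyIntegrable
  have hΦsupp : ∀ n, HasCompactSupport (Φ n) := fun n =>
    HasCompactSupport.convolution _ (k n).hasCompactSupport_normed hs
  obtain ⟨ρ, hρ⟩ := hs.isCompact.isBounded.subset_closedBall 0
  have hΦzero : ∀ n, tsupport (Φ n) ⊆ closedBall 0 (ρ + 1) := by
    intro n
    refine closure_minimal ?_ isClosed_closedBall
    intro x hx
    obtain ⟨y, hy, z, hz, rfl⟩ := support_convolution_subset _ hx
    rw [(k n).support_normed_eq, mem_ball_zero_iff] at hy
    have hz' : ‖z‖ ≤ ρ := by simpa using hρ (subset_tsupport _ hz)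
    rw [mem_closedBall_zero_iff]
    linarith [norm_add_le y z, hk1 n]
  obtain ⟨M, hM0, hM⟩ := hs.exists_bound_abs hφ.continuous
  choose M' hM'0 hM' using fun i =>
    (hs.partialDeriv i).exists_bound_abs (hφ.continuous_partialDeriv i)
  have hlim : Tendsto (fun n => energyForm c (Φ n) (Φ n)) atTop (𝓝 (energyForm c φ φ)) := by
    refine tendsto_integral_of_dominated_convergence
      ((closedBall 0 (ρ + 1)).indicator fun x =>
        ∑ i, 3 * M' i * (3 * M' i) + |c x| * (3 * M) * (3 * M)) ?_ ?_ ?_ ?_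
    · intro n
      exact (integrable_energyForm hc ((hΦsmooth n).of_le (by norm_cast))
        ((hΦsmooth n).of_le (by norm_cast)) (hΦsupp n)).aestronglyMeasurable
    · rw [integrable_indicator_iff measurableSet_closedBall]
      refine ContinuousOn.integrableOn_compact (isCompact_closedBall _ _) ?_
      fun_prop
    · intro n
      refine Eventually.of_forall fun x => ?_
      by_cases hx : x ∈ closedBall 0 (ρ + 1)
      · rw [indicator_of_mem hx, Real.norm_eq_abs]
        have hb : |Φ n x| ≤ 3 * M := norm_normed_convolution_le (k n) hφ.continuous hM x
        have hb' : ∀ i, |partialDeriv i (Φ n) x| ≤ 3 * M' i := fun i => by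
          change |partialDeriv i (convolution _ _ _ _) x| ≤ _
          rw [partialDeriv_convolution (k n) hφ hs]
          exact norm_normed_convolution_le (k n) (hφ.continuous_partialDeriv i) (hM' i) x
        refine (abs_sub _ _).trans (add_le_add ?_ ?_)
        · refine (Finset.abs_sum_le_sum_abs _ _).trans (Finset.sum_le_sum fun i _ => ?_)
          rw [abs_mul]
          exact mul_le_mul (hb' i) (hb' i) (abs_nonneg _) (by linarith [hM'0 i])
        · rw [abs_mul, abs_mul]
          gcongr
      · rw [indicator_of_notMem hx]
        have h0 : Φ n x = 0 := image_eq_zero_of_notMem_tsupport fun h => hx (hΦzero n h)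
        have h1 : fderiv ℝ (Φ n) x = 0 := image_eq_zero_of_notMem_tsupport fun h =>
          hx (hΦzero n (tsupport_fderiv_subset ℝ h))
        simp [h0, partialDeriv, h1]
    · refine Eventually.of_forall fun x => ?_
      have h0 : Tendsto (fun n => Φ n x) atTop (𝓝 (φ x)) :=
        ContDiffBump.convolution_tendsto_right_of_continuous hk hφ.continuous x
      have h1 : ∀ i, Tendsto (fun n => partialDeriv i (Φ n) x) atTop (𝓝 (partialDeriv i φ x)) := by
        intro i
        have := ContDiffBump.convolution_tendsto_right_of_continuous (μ := volume) hk
          (hφ.continuous_partialDeriv i) x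
        refine this.congr fun n => ?_
        exact (partialDeriv_convolution (k n) hφ hs i x).symm
      exact (tendsto_finsetSum _ fun i _ => (h1 i).mul (h1 i)).sub
        ((h0.const_mul (c x)).mul h0)
  exact ge_of_tendsto' hlim fun n => hst _ (hΦsmooth n) (hΦsupp n)

end Mollification

section Truncation

theorem sq_intervalIntegral_le_mul {θ : ℝ → ℝ} (hθ : Continuous θ) {s : ℝ} (hs : 0 ≤ s) :
    (∫ t in (0 : ℝ)..s, θ t) ^ 2 ≤ s * ∫ t in (0 : ℝ)..s, θ t ^ 2 := by
  rcases hs.eq_or_lt with rfl | hs'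
  · simp
  set a := (∫ t in (0 : ℝ)..s, θ t) / s with ha
  have h0 : 0 ≤ ∫ t in (0 : ℝ)..s, (θ t - a) ^ 2 :=
    intervalIntegral.integral_nonneg hs fun t _ => sq_nonneg _
  have hexp : ∫ t in (0 : ℝ)..s, (θ t - a) ^ 2 =
      (∫ t in (0 : ℝ)..s, θ t ^ 2) - 2 * a * (∫ t in (0 : ℝ)..s, θ t) + s * a ^ 2 := by
    have h1 : ∀ t, (θ t - a) ^ 2 = θ t ^ 2 - 2 * a * θ t + a ^ 2 := fun t => by ring
    have i1 : IntervalIntegrable (fun t => θ t ^ 2) volume 0 s :=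
      (hθ.pow 2).intervalIntegrable _ _
    have i2 : IntervalIntegrable (fun t => 2 * a * θ t) volume 0 s :=
      (continuous_const.mul hθ).intervalIntegrable _ _
    simp only [h1]
    rw [intervalIntegral.integral_add (i1.sub i2) (by simp), intervalIntegral.integral_sub i1 i2,
      intervalIntegral.integral_const_mul]
    simp
  have hI : (∫ t in (0 : ℝ)..s, θ t) = a * s := by rw [ha]; field_simp
  rw [hexp, hI] at h0
  rw [hI]
  nlinarith

/-- `C¹` approximations `G` of the positive part, vanishing below `ε`, together with the
primitive `H` of the square of the derivative of `G`. -/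
theorem exists_truncation {ε : ℝ} (hε : 0 < ε) :
    ∃ G H : ℝ → ℝ, ContDiff ℝ 1 G ∧ ContDiff ℝ 1 H ∧ (∀ s, deriv H s = deriv G s ^ 2) ∧
      (∀ s ≤ ε, G s = 0 ∧ H s = 0) ∧ (∀ s, 0 ≤ G s) ∧ (∀ s, s - 2 * ε ≤ G s) ∧
      (∀ s, 0 ≤ s → G s ^ 2 ≤ s * H s) ∧ ∀ s, 0 ≤ s → s * H s - G s ^ 2 ≤ 4 * ε * s := by
  set θ : ℝ → ℝ := fun t => min 1 (max 0 ((t - ε) / ε)) with hθ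
  have hc : Continuous θ := by fun_prop
  have h0 : ∀ t, 0 ≤ θ t := fun t => le_min zero_le_one (le_max_left _ _)
  have h1 : ∀ t, θ t ≤ 1 := fun t => min_le_left _ _
  have hz : ∀ t ≤ ε, θ t = 0 := fun t ht => by
    have : (t - ε) / ε ≤ 0 := div_nonpos_of_nonpos_of_nonneg (by linarith) hε.le
    simp [hθ, max_eq_left this]
  have hone : ∀ t, 2 * ε ≤ t → θ t = 1 := fun t ht => by
    have : 1 ≤ (t - ε) / ε := by rw [le_div_iff₀ hε]; linarith
    simp [hθ, this]
  have hGd : ∀ s, HasDerivAt (fun s => ∫ t in (0 : ℝ)..s, θ t) (θ s) s := fun s =>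
    intervalIntegral.integral_hasDerivAt_right (hc.intervalIntegrable _ _)
      (hc.stronglyMeasurableAtFilter _ _) hc.continuousAt
  have hc2 : Continuous fun t => θ t ^ 2 := hc.pow 2
  have hHd : ∀ s, HasDerivAt (fun s => ∫ t in (0 : ℝ)..s, θ t ^ 2) (θ s ^ 2) s := fun s =>
    intervalIntegral.integral_hasDerivAt_right (hc2.intervalIntegrable _ _)
      (hc2.stronglyMeasurableAtFilter _ _) hc2.continuousAt
  have hGz : ∀ s ≤ ε, ∀ t ∈ uIcc 0 s, θ t = 0 := fun s hs t ht =>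
    hz t (ht.2.trans (max_le hε.le hs))
  have hG0 : ∀ s, 0 ≤ s → 0 ≤ ∫ t in (0 : ℝ)..s, θ t := fun s hs =>
    intervalIntegral.integral_nonneg hs fun t _ => h0 t
  have hGzero : ∀ s ≤ ε, ∫ t in (0 : ℝ)..s, θ t = 0 := fun s hs =>
    (intervalIntegral.integral_congr (hGz s hs)).trans (by simp)
  have hGnonneg : ∀ s, 0 ≤ ∫ t in (0 : ℝ)..s, θ t := fun s => by
    rcases le_total s ε with h | h
    · exact (hGzero s h).ge
    · exact hG0 s (hε.le.trans h)
  have hGlow : ∀ s, s - 2 * ε ≤ ∫ t in (0 : ℝ)..s, θ t := fun s => by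
    rcases le_total s (2 * ε) with h | h
    · linarith [hGnonneg s]
    · rw [← intervalIntegral.integral_add_adjacent_intervals (b := 2 * ε)
        (hc.intervalIntegrable _ _) (hc.intervalIntegrable _ _)]
      have : ∫ t in (2 * ε)..s, θ t = s - 2 * ε := by
        rw [intervalIntegral.integral_congr (g := fun _ => (1 : ℝ)) fun t ht => hone t ?_]
        · simp
        · rw [uIcc_of_le h] at ht
          exact ht.1
      linarith [hGnonneg (2 * ε)]
  refine ⟨fun s => ∫ t in (0 : ℝ)..s, θ t, fun s => ∫ t in (0 : ℝ)..s, θ t ^ 2,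
    contDiff_one_iff_deriv.2 ⟨fun s => (hGd s).differentiableAt, ?_⟩,
    contDiff_one_iff_deriv.2 ⟨fun s => (hHd s).differentiableAt, ?_⟩, fun s => ?_,
    fun s hs => ⟨hGzero s hs, ?_⟩, hGnonneg, hGlow, fun s hs => sq_intervalIntegral_le_mul hc hs,
    fun s hs => ?_⟩
  · rwa [funext fun s => (hGd s).deriv]
  · rwa [funext fun s => (hHd s).deriv]
  · rw [(hGd s).deriv, (hHd s).deriv]
  · have : EqOn (fun t => θ t ^ 2) (fun _ => 0) (uIcc 0 s) := fun t ht => by simp [hGz s hs t ht]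
    exact (intervalIntegral.integral_congr this).trans (by simp)
  · have hH : ∫ t in (0 : ℝ)..s, θ t ^ 2 ≤ s := by
      have := intervalIntegral.integral_mono_on hs (hc2.intervalIntegrable 0 s)
        (intervalIntegrable_const : IntervalIntegrable (fun _ : ℝ => (1 : ℝ)) volume 0 s)
        fun t _ => pow_le_one₀ (h0 t) (h1 t)
      simpa using this
    have hH' := mul_le_mul_of_nonneg_left hH hs
    have hg := hGlow s
    have hg0 := hGnonneg s
    rcases le_total s (2 * ε) with h | h
    · nlinarith
    · nlinarith [pow_le_pow_left₀ (by linarith) hg 2]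

end Truncation

section Barrier

theorem hasDerivAt_max_zero_pow (n : ℕ) (s : ℝ) :
    HasDerivAt (fun t : ℝ => max t 0 ^ (n + 2)) ((n + 2) * max s 0 ^ (n + 1)) s := by
  rcases lt_trichotomy s 0 with h | rfl | h
  · have he : (fun t : ℝ => max t 0 ^ (n + 2)) =ᶠ[𝓝 s] fun _ => 0 := by
      filter_upwards [Iio_mem_nhds h] with t (ht : t < 0)
      simp [max_eq_right ht.le]
    simpa [max_eq_right h.le] using (hasDerivAt_const s (0 : ℝ)).congr_of_eventuallyEq he
  · simp only [max_self, ne_eq, Nat.add_eq_zero_iff, one_ne_zero, and_false, not_false_eq_true,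
      zero_pow, mul_zero]
    rw [hasDerivAt_iff_isLittleO]
    have h1 : (fun t : ℝ => max t 0 ^ (n + 1)) =o[𝓝 0] fun _ => (1 : ℝ) := by
      rw [Asymptotics.isLittleO_one_iff]
      have : Continuous fun t : ℝ => max t 0 ^ (n + 1) := by fun_prop
      simpa using this.tendsto 0
    have h2 : (fun t : ℝ => max t 0) =O[𝓝 0] fun t => t :=
      Asymptotics.IsBigO.of_bound 1 (Eventually.of_forall fun t => by
        rw [one_mul, Real.norm_eq_abs, Real.norm_eq_abs, abs_of_nonneg (le_max_right _ _)]
        exact max_le (le_abs_self t) (abs_nonneg t))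
    simpa [pow_succ] using h1.mul_isBigO h2
  · have he : (fun t : ℝ => max t 0 ^ (n + 2)) =ᶠ[𝓝 s] fun t => t ^ (n + 2) := by
      filter_upwards [Ioi_mem_nhds h] with t (ht : 0 < t)
      simp [max_eq_left ht.le]
    have := (hasDerivAt_pow (n + 2) s).congr_of_eventuallyEq he
    simpa [max_eq_left h.le] using this

theorem contDiff_max_zero_pow (n : ℕ) : ContDiff ℝ (n + 1) fun t : ℝ => max t 0 ^ (n + 2) := by
  induction n with
  | zero =>
    simp only [Nat.cast_zero, zero_add]
    refine contDiff_one_iff_deriv.2 ⟨fun s => (hasDerivAt_max_zero_pow 0 s).differentiableAt, ?_⟩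
    rw [funext fun s => (hasDerivAt_max_zero_pow 0 s).deriv]
    fun_prop
  | succ n ih =>
    refine contDiff_succ_iff_deriv.2
      ⟨fun s => (hasDerivAt_max_zero_pow (n + 1) s).differentiableAt, by simp, ?_⟩
    have hd : (deriv fun t : ℝ => max t 0 ^ (n + 1 + 2)) =
        fun s => ((n + 1 : ℕ) + 2 : ℝ) * max s 0 ^ (n + 2) :=
      funext fun s => (hasDerivAt_max_zero_pow (n + 1) s).deriv
    rw [hd]
    push_cast
    exact contDiff_const.mul ih

variable {N : ℕ}

theorem coordLaplacian_barrier (n : ℕ) (R : ℝ) (x₀ x : EuclideanSpace ℝ (Fin N)) :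
    coordLaplacian (fun y => max (R ^ 2 - ‖y - x₀‖ ^ 2) 0 ^ (n + 3)) x =
      (n + 3) * max (R ^ 2 - ‖x - x₀‖ ^ 2) 0 ^ (n + 1) *
        (4 * (n + 2) * ‖x - x₀‖ ^ 2 - 2 * N * max (R ^ 2 - ‖x - x₀‖ ^ 2) 0) := by
  set q : EuclideanSpace ℝ (Fin N) → ℝ := fun y => R ^ 2 - ‖y - x₀‖ ^ 2 with hq
  have hqc : ContDiff ℝ 2 q := contDiff_const.sub ((contDiff_id.sub contDiff_const).norm_sq ℝ)
  have hqd : Differentiable ℝ q := hqc.differentiable (by norm_num)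
  have hnd : Differentiable ℝ fun y : EuclideanSpace ℝ (Fin N) => ‖y - x₀‖ ^ 2 :=
    ((contDiff_id.sub contDiff_const).norm_sq ℝ (n := 1)).differentiable (by norm_num)
  have hpq : ∀ i y, partialDeriv i q y = -2 * (y i - x₀ i) := by
    intro i y
    rw [hq, partialDeriv_sub (differentiableAt_const _) (hnd y), partialDeriv_const,
      partialDeriv_norm_sq]
    ring
  have hfirst : ∀ i, partialDeriv i (fun y => max (q y) 0 ^ (n + 3)) =
      fun y => -2 * (n + 3) * (max (q y) 0 ^ (n + 2) * (y i - x₀ i)) := by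
    intro i
    ext y
    rw [partialDeriv_comp (hasDerivAt_max_zero_pow (n + 1) (q y)) (hqd y), hpq]
    push_cast
    ring
  have hsecond : ∀ i, partialDeriv i (partialDeriv i (fun y => max (q y) 0 ^ (n + 3))) x =
      -2 * (n + 3) * (-2 * (n + 2) * max (q x) 0 ^ (n + 1) * (x i - x₀ i) ^ 2 +
        max (q x) 0 ^ (n + 2)) := by
    intro i
    have hd1 : HasFDerivAt (fun y => max (q y) 0 ^ (n + 2)) _ x :=
      (hasDerivAt_max_zero_pow n (q x)).comp_hasFDerivAt x (hqd x).hasFDerivAt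
    have hd2 : HasFDerivAt (fun y : EuclideanSpace ℝ (Fin N) => y i - x₀ i)
        (EuclideanSpace.proj i : EuclideanSpace ℝ (Fin N) →L[ℝ] ℝ) x :=
      (EuclideanSpace.proj (𝕜 := ℝ) i).hasFDerivAt.sub_const _
    have hd : HasFDerivAt (fun y => max (q y) 0 ^ (n + 2) * (y i - x₀ i)) _ x := hd1.mul hd2
    rw [hfirst, partialDeriv_const_mul hd.differentiableAt, partialDeriv,
      hd.fderiv]
    have := hpq i x
    rw [partialDeriv] at this
    simp [this]
    left
    ring
  rw [coordLaplacian_eq_sum]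
  change ∑ i, partialDeriv i (partialDeriv i (fun y => max (q y) 0 ^ (n + 3))) x =
    (n + 3) * max (q x) 0 ^ (n + 1) *
      (4 * (n + 2) * ‖x - x₀‖ ^ 2 - 2 * N * max (q x) 0)
  simp only [hsecond, ← Finset.mul_sum, Finset.sum_add_distrib, Finset.sum_const,
    Finset.card_univ, Fintype.card_fin, nsmul_eq_mul]
  have hnorm : ∑ i, (x i - x₀ i) ^ 2 = ‖x - x₀‖ ^ 2 := by
    simp [EuclideanSpace.norm_sq_eq]
  rw [hnorm]
  ring

/-- On the annulus `r ≤ |x - x₀| < R` there are strict subsolutions of `Δ + c`, of class `C²` and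
vanishing outside the ball of radius `R`. -/
theorem exists_barrier {c : EuclideanSpace ℝ (Fin N) → ℝ} (hc : Continuous c)
    (x₀ : EuclideanSpace ℝ (Fin N)) {r R : ℝ} (hr : 0 < r) (hR : 0 < R) :
    ∃ χ : EuclideanSpace ℝ (Fin N) → ℝ, ContDiff ℝ 2 χ ∧ HasCompactSupport χ ∧
      (∀ x, r ≤ ‖x - x₀‖ → 0 ≤ coordLaplacian χ x + c x * χ x) ∧
      ∀ x, r ≤ ‖x - x₀‖ → ‖x - x₀‖ < R → 0 < coordLaplacian χ x + c x * χ x := by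
  obtain ⟨M, hM⟩ := (isCompact_closedBall x₀ R).exists_bound_of_continuousOn hc.continuousOn
  obtain ⟨n, hn⟩ := exists_nat_gt ((2 * N * R ^ 2 + |M| * (R ^ 2) ^ 2) / (4 * r ^ 2))
  rw [div_lt_iff₀ (by positivity)] at hn
  have hpos : ∀ x, r ≤ ‖x - x₀‖ → 0 < R ^ 2 - ‖x - x₀‖ ^ 2 → x ∈ closedBall x₀ R →
      0 < coordLaplacian (fun y => max (R ^ 2 - ‖y - x₀‖ ^ 2) 0 ^ (n + 3)) x +
        c x * max (R ^ 2 - ‖x - x₀‖ ^ 2) 0 ^ (n + 3) := by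
    intro x hx hR hmem
    rw [coordLaplacian_barrier, max_eq_left hR.le]
    set s := R ^ 2 - ‖x - x₀‖ ^ 2 with hs
    have hcx : -|M| ≤ c x := (abs_le.1 ((hM x hmem).trans (le_abs_self M))).1
    have hsR : s ≤ R ^ 2 := by rw [hs]; linarith [sq_nonneg ‖x - x₀‖]
    have hx2 : r ^ 2 ≤ ‖x - x₀‖ ^ 2 := pow_le_pow_left₀ hr.le hx 2
    have hfac : (n + 3) * s ^ (n + 1) * (4 * (n + 2) * ‖x - x₀‖ ^ 2 - 2 * N * s) +
        c x * s ^ (n + 3) = s ^ (n + 1) *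
          ((n + 3) * (4 * (n + 2) * ‖x - x₀‖ ^ 2 - 2 * N * s) + c x * s ^ 2) := by ring
    rw [hfac]
    refine mul_pos (pow_pos hR _) ?_
    have h1 : -(|M| * (R ^ 2) ^ 2) ≤ c x * s ^ 2 := by
      have h2 : s ^ 2 ≤ (R ^ 2) ^ 2 := pow_le_pow_left₀ hR.le hsR 2
      have h3 := mul_le_mul_of_nonneg_right hcx (sq_nonneg s)
      have h4 := mul_le_mul_of_nonneg_left h2 (abs_nonneg M)
      linarith
    have h5 : 2 * N * s ≤ 2 * N * R ^ 2 := by gcongr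
    have h6 : (4 * (n : ℝ)) * r ^ 2 ≤ 4 * (n + 2) * ‖x - x₀‖ ^ 2 := by gcongr; linarith
    have h7 : 0 ≤ |M| * (R ^ 2) ^ 2 := by positivity
    have h8 : |M| * (R ^ 2) ^ 2 < 4 * (n + 2) * ‖x - x₀‖ ^ 2 - 2 * N * s := by linarith
    have h9 : (0 : ℝ) ≤ n := n.cast_nonneg
    nlinarith
  refine ⟨fun y => max (R ^ 2 - ‖y - x₀‖ ^ 2) 0 ^ (n + 3), ?_, ?_, fun x hx => ?_,
    fun x hx hxR => ?_⟩
  · have h := contDiff_max_zero_pow (n + 1)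
    have h' : ContDiff ℝ 2 fun t : ℝ => max t 0 ^ (n + 3) := h.of_le (by
      norm_cast
      omega)
    exact h'.comp (contDiff_const.sub ((contDiff_id.sub contDiff_const).norm_sq ℝ))
  · refine HasCompactSupport.intro (isCompact_closedBall x₀ |R|) fun x hx => ?_
    rw [mem_closedBall, not_le, dist_eq_norm] at hx
    have : R ^ 2 - ‖x - x₀‖ ^ 2 ≤ 0 := by
      have := pow_le_pow_left₀ (abs_nonneg R) hx.le 2
      rw [sq_abs] at this
      linarith
    simp [max_eq_right this]
  · by_cases h : 0 < R ^ 2 - ‖x - x₀‖ ^ 2 ∧ x ∈ closedBall x₀ R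
    · exact (hpos x hx h.1 h.2).le
    · have : R ^ 2 - ‖x - x₀‖ ^ 2 ≤ 0 := by
        by_contra! hlt
        have hxR : ‖x - x₀‖ < R := lt_of_pow_lt_pow_left₀ 2 hR.le (by linarith)
        exact h ⟨hlt, by simpa [dist_eq_norm] using hxR.le⟩
      rw [coordLaplacian_barrier, max_eq_right this]
      simp [max_eq_right this]
  · refine hpos x hx ?_ (by simpa [dist_eq_norm] using hxR.le)
    nlinarith [norm_nonneg (x - x₀)]

end Barrier

section Sign

variable {N : ℕ} {c v : EuclideanSpace ℝ (Fin N) → ℝ}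

/-- The energy of the truncations `(v - ε)₊` of a weak solution `v` of `Δv + cv = 0` that decays at
infinity is of order `ε`, provided that `c ≤ 0` near infinity. -/
theorem exists_truncation_energyForm_le (hc : Continuous c) (hv : ContDiff ℝ 1 v)
    (hv0 : Tendsto v (cocompact (EuclideanSpace ℝ (Fin N))) (𝓝 0))
    (hw : ∀ ζ, ContDiff ℝ 1 ζ → HasCompactSupport ζ → energyForm c v ζ = 0) {ρ : ℝ}
    (hρ : ∀ x ∉ closedBall 0 ρ, c x ≤ 0) :
    ∃ K : ℝ, ∀ ε > 0, ∃ w, ContDiff ℝ 1 w ∧ HasCompactSupport w ∧ (∀ x, 0 ≤ w x) ∧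
      (∀ x, v x - 2 * ε ≤ w x) ∧ (∀ x, v x ≤ 0 → w x = 0) ∧ energyForm c w w ≤ ε * K := by
  refine ⟨∫ x in closedBall 0 ρ, 4 * |c x| * |v x|, fun ε hε => ?_⟩
  obtain ⟨G, H, hG, hH, hGH, hz, hG0, hGlow, hlo, hhi⟩ := exists_truncation hε
  obtain ⟨S, hS, hSv⟩ := mem_cocompact.1 (hv0.eventually (Iio_mem_nhds hε))
  have hvd : Differentiable ℝ v := hv.differentiable (by norm_num)
  have hGd : ∀ s, HasDerivAt G (deriv G s) s := fun s =>
    (hG.differentiable (by norm_num) s).hasDerivAt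
  have hHd : ∀ s, HasDerivAt H (deriv H s) s := fun s =>
    (hH.differentiable (by norm_num) s).hasDerivAt
  have hGs : HasCompactSupport fun x => G (v x) :=
    HasCompactSupport.intro hS fun x hx => (hz _ (hSv hx).le).1
  have hHs : HasCompactSupport fun x => H (v x) :=
    HasCompactSupport.intro hS fun x hx => (hz _ (hSv hx).le).2
  have hGc : ContDiff ℝ 1 fun x => G (v x) := hG.comp hv
  have hHc : ContDiff ℝ 1 fun x => H (v x) := hH.comp hv
  refine ⟨fun x => G (v x), hGc, hGs, fun x => hG0 _, fun x => hGlow _,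
    fun x hx => (hz _ (hx.trans hε.le)).1, ?_⟩
  have i1 := integrable_energyForm hc hGc hGc hGs
  have i2 := integrable_energyForm hc hv hHc hHs
  have hpt : ∀ x, (∑ i, partialDeriv i (fun x => G (v x)) x * partialDeriv i (fun x => G (v x)) x -
      c x * G (v x) * G (v x)) - (∑ i, partialDeriv i v x * partialDeriv i (fun x => H (v x)) x -
      c x * v x * H (v x)) = c x * (v x * H (v x) - G (v x) ^ 2) := by
    intro x
    have : ∀ i, partialDeriv i (fun x => G (v x)) x * partialDeriv i (fun x => G (v x)) x =
        partialDeriv i v x * partialDeriv i (fun x => H (v x)) x := fun i => by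
      rw [partialDeriv_comp (hGd _) (hvd x), partialDeriv_comp (hHd _) (hvd x), hGH]
      ring
    simp only [this]
    ring
  have hE : energyForm c (fun x => G (v x)) (fun x => G (v x)) =
      ∫ x, c x * (v x * H (v x) - G (v x) ^ 2) := by
    rw [← sub_zero (energyForm c (fun x => G (v x)) _), ← hw _ hHc hHs, energyForm, energyForm,
      ← integral_sub i1 i2]
    exact integral_congr_ae (Eventually.of_forall hpt)
  have hint : Integrable fun x => c x * (v x * H (v x) - G (v x) ^ 2) :=
    (i1.sub i2).congr (Eventually.of_forall hpt)
  have hK : IntegrableOn (fun x => 4 * |c x| * |v x|) (closedBall 0 ρ) :=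
    ContinuousOn.integrableOn_compact (isCompact_closedBall _ _)
      ((continuous_const.mul hc.abs).mul hv.continuous.abs).continuousOn
  rw [hE, ← integral_const_mul, ← integral_indicator measurableSet_closedBall]
  refine integral_mono hint
    (IntegrableOn.integrable_indicator (hK.const_mul ε) measurableSet_closedBall) fun x => ?_
  have hlow : 0 ≤ v x * H (v x) - G (v x) ^ 2 := by
    rcases le_total 0 (v x) with h | h
    · linarith [hlo _ h]
    · simp [hz _ (h.trans hε.le)]
  have hup : v x * H (v x) - G (v x) ^ 2 ≤ 4 * ε * |v x| := by
    rcases le_total 0 (v x) with h | h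
    · simpa [abs_of_nonneg h] using hhi _ h
    · simp [hz _ (h.trans hε.le)]
      positivity
  by_cases hx : x ∈ closedBall 0 ρ
  · rw [indicator_of_mem hx]
    calc c x * (v x * H (v x) - G (v x) ^ 2) ≤ |c x| * (v x * H (v x) - G (v x) ^ 2) :=
          mul_le_mul_of_nonneg_right (le_abs_self _) hlow
      _ ≤ |c x| * (4 * ε * |v x|) := mul_le_mul_of_nonneg_left hup (abs_nonneg _)
      _ = ε * (4 * |c x| * |v x|) := by ring
  · rw [indicator_of_notMem hx]
    exact mul_nonpos_of_nonpos_of_nonneg (hρ x hx) hlow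

theorem exists_pos_small_of_linear_bound {κ K Q : ℝ} (hκ : 0 < κ) {ε₀ : ℝ} (hε₀ : 0 < ε₀) :
    ∃ t > 0, ∃ ε > 0, ε ≤ ε₀ ∧ ε * K - 2 * t * κ + t ^ 2 * Q < 0 := by
  have hQ : 0 < |Q| + 1 := by positivity
  have hK : 0 < |K| + 1 := by positivity
  set t := κ / (|Q| + 1) with ht
  have htp : 0 < t := div_pos hκ hQ
  have htQ : t * (|Q| + 1) = κ := by rw [ht]; field_simp
  refine ⟨t, htp, min ε₀ (t * κ / (2 * (|K| + 1))), lt_min hε₀ (by positivity), min_le_left _ _, ?_⟩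
  set ε := min ε₀ (t * κ / (2 * (|K| + 1)))
  have hε : 0 < ε := lt_min hε₀ (by positivity)
  have h1 : ε * (2 * (|K| + 1)) ≤ t * κ :=
    (le_div_iff₀ (by positivity)).1 (min_le_right _ _)
  have h2 : ε * K ≤ ε * (|K| + 1) := by gcongr; linarith [le_abs_self K]
  have h3 : t ^ 2 * Q ≤ t ^ 2 * (|Q| + 1) := by gcongr; linarith [le_abs_self Q]
  have h4 : t ^ 2 * (|Q| + 1) = t * κ := by rw [← htQ]; ring
  have h5 : 0 < t * κ := by positivity
  linarith

/-- If the form `φ ↦ ∫ |∇φ|² - cφ²` is nonnegative, with `c ≤ 0` near infinity, then weak solutions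
of `Δv + cv = 0` that decay at infinity do not change sign. -/
theorem nonneg_or_nonpos_of_energyForm_nonneg (hc : Continuous c) (hv : ContDiff ℝ 1 v)
    (hv0 : Tendsto v (cocompact (EuclideanSpace ℝ (Fin N))) (𝓝 0))
    (hw : ∀ ζ, ContDiff ℝ 1 ζ → HasCompactSupport ζ → energyForm c v ζ = 0) {ρ : ℝ}
    (hρ : ∀ x ∉ closedBall 0 ρ, c x ≤ 0)
    (hst : ∀ φ, ContDiff ℝ 1 φ → HasCompactSupport φ → 0 ≤ energyForm c φ φ) :
    (∀ x, 0 ≤ v x) ∨ ∀ x, v x ≤ 0 := by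
  by_contra! hcon
  obtain ⟨⟨x₀, hx₀⟩, y, hy⟩ := hcon
  obtain ⟨K, hK⟩ := exists_truncation_energyForm_le hc hv hv0 hw hρ
  obtain ⟨r, hr, hball⟩ := Metric.nhds_basis_closedBall.mem_iff.1
    (hv.continuous.continuousAt.preimage_mem_nhds (Iio_mem_nhds hx₀))
  have hneg : ∀ x, ‖x - x₀‖ ≤ r → v x < 0 := fun x hx =>
    hball (mem_closedBall.2 (by rwa [dist_eq_norm]))
  have hyr : r ≤ ‖y - x₀‖ := by
    by_contra! h
    exact hy.not_gt (hneg y h.le)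
  obtain ⟨χ, hχ, hχs, hχ0, hχpos⟩ := exists_barrier hc x₀ hr
    (R := ‖y - x₀‖ + 1) (by positivity)
  set g : EuclideanSpace ℝ (Fin N) → ℝ := fun x => coordLaplacian χ x + c x * χ x with hg
  have hgc : Continuous g := hχ.continuous_coordLaplacian.add (hc.mul hχ.continuous)
  set b : EuclideanSpace ℝ (Fin N) → ℝ := fun x => max (v x - v y / 2) 0 with hb
  have hbc : Continuous b := (hv.continuous.sub continuous_const).max continuous_const
  have hbs : HasCompactSupport b := by
    obtain ⟨S, hS, hSv⟩ := mem_cocompact.1 (hv0.eventually (Iio_mem_nhds (half_pos hy)))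
    exact HasCompactSupport.intro hS fun x hx => max_eq_right (by
      have : v x < v y / 2 := hSv hx
      linarith)
  have hbneg : ∀ x, v x ≤ 0 → b x = 0 := fun x hx => max_eq_right (by linarith)
  have hmul : ∀ p : EuclideanSpace ℝ (Fin N) → ℝ, (∀ x, 0 ≤ p x) → (∀ x, v x ≤ 0 → p x = 0) →
      ∀ x, 0 ≤ g x * p x := by
    intro p hp0 hpz x
    rcases le_total r ‖x - x₀‖ with h | h
    · exact mul_nonneg (hχ0 x h) (hp0 x)
    · simp [hpz x (hneg x h).le]
  have hκ : 0 < ∫ x, g x * b x := by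
    refine Continuous.integral_pos_of_hasCompactSupport_nonneg_nonzero (x := y) (hgc.mul hbc)
      hbs.mul_left (hmul b (fun x => le_max_right _ _) hbneg) ?_
    refine (mul_pos (hχpos y hyr (by linarith)) (lt_max_of_lt_left ?_)).ne'
    linarith
  obtain ⟨t, ht, ε, hε, hεy, hlt⟩ := exists_pos_small_of_linear_bound
    (K := K) (Q := energyForm c χ χ) hκ (show 0 < v y / 4 by positivity)
  obtain ⟨w, hwc, hws, hw0, hwlow, hwneg, hwe⟩ := hK ε hε
  have hχ1 : ContDiff ℝ 1 χ := hχ.of_le (by norm_num)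
  have h1 : 0 ≤ energyForm c w w + 2 * t * energyForm c w χ + t ^ 2 * energyForm c χ χ := by
    rw [← energyForm_add_const_mul_self hc hwc hχ1 hws hχs]
    exact hst _ (hwc.add (contDiff_const.mul hχ1)) (hws.add hχs.mul_left)
  rw [energyForm_comm (φ := w) (ψ := χ), energyForm_eq_neg_integral hc hχ hwc hws] at h1
  have h2 : ∫ x, g x * b x ≤ ∫ x, g x * w x := by
    refine integral_mono ((hgc.mul hbc).integrable_of_hasCompactSupport hbs.mul_left)
      ((hgc.mul hwc.continuous).integrable_of_hasCompactSupport hws.mul_left) fun x => ?_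
    have h3 := hmul (fun x => w x - b x)
      (fun x => sub_nonneg.2 (max_le (by linarith [hwlow x]) (hw0 x)))
      (fun x hx => by simp [hwneg x hx, hbneg x hx]) x
    simp only [mul_sub] at h3
    linarith
  have h4 := mul_le_mul_of_nonneg_left h2 ht.le
  linarith

end Sign

section Stability

variable {N : ℕ}

/-- Decaying functions on `ℝ^N` that are monotone along a coordinate direction vanish. -/
theorem eq_zero_of_partialDeriv_nonneg {u : EuclideanSpace ℝ (Fin N) → ℝ} (hu : Differentiable ℝ u)
    (h0 : Tendsto u (cocompact (EuclideanSpace ℝ (Fin N))) (𝓝 0)) {i : Fin N}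
    (hi : ∀ x, 0 ≤ partialDeriv i u x) (x : EuclideanSpace ℝ (Fin N)) : u x = 0 := by
  have hmono : Monotone fun s : ℝ => u (x + s • EuclideanSpace.single i 1) :=
    monotone_of_deriv_nonneg (fun s => (hasDerivAt_line (hu _)).differentiableAt)
      fun s => by
        rw [(hasDerivAt_line (hu _)).deriv]
        exact hi _
  have hline : Tendsto (fun s : ℝ => x + s • EuclideanSpace.single i (1 : ℝ)) (cocompact ℝ)
      (cocompact (EuclideanSpace ℝ (Fin N))) := by
    refine (Topology.IsClosedEmbedding.tendsto_cocompact ?_)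
    exact (Homeomorph.addLeft x).isClosedEmbedding.comp
      (isClosedEmbedding_smul_left (by simp))
  have hlim := h0.comp hline
  rw [cocompact_eq_atBot_atTop, tendsto_sup] at hlim
  have hle := hmono.ge_of_tendsto hlim.2 0
  have hge := hmono.le_of_tendsto hlim.1 0
  simp only [zero_smul, add_zero] at hle hge
  exact le_antisymm hle hge

/-- A decaying solution of `Δu + f(u) = 0` with `f` nonincreasing near `0` vanishes if it is
stable. -/
theorem eq_zero_of_energyForm_nonneg (i : Fin N) {f : ℝ → ℝ} (hf : ContDiff ℝ 1 f) (hf0 : f 0 = 0)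
    {δ : ℝ} (hδ : 0 < δ) (hf' : ∀ s : ℝ, |s| ≤ δ → deriv f s ≤ 0)
    {u : EuclideanSpace ℝ (Fin N) → ℝ} (hu : ContDiff ℝ 2 u)
    (heq : ∀ x, coordLaplacian u x + f (u x) = 0)
    (h0 : Tendsto u (cocompact (EuclideanSpace ℝ (Fin N))) (𝓝 0))
    (hst : ∀ φ, ContDiff ℝ (⊤ : ℕ∞) φ → HasCompactSupport φ →
      0 ≤ energyForm (fun x => deriv f (u x)) φ φ) (x : EuclideanSpace ℝ (Fin N)) : u x = 0 := by
  have hc : Continuous fun x => deriv f (u x) :=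
    (hf.continuous_deriv (by norm_num)).comp hu.continuous
  have hL : Tendsto (coordLaplacian u) (cocompact (EuclideanSpace ℝ (Fin N))) (𝓝 0) := by
    have h : Tendsto (fun x => -f (u x)) (cocompact (EuclideanSpace ℝ (Fin N))) (𝓝 (-f 0)) :=
      ((hf.continuous.tendsto 0).comp h0).neg
    rw [hf0, neg_zero] at h
    exact h.congr fun x => by linarith [heq x]
  obtain ⟨ρ, hρ⟩ : ∃ ρ, ∀ x ∉ closedBall 0 ρ, deriv f (u x) ≤ 0 := by
    obtain ⟨S, hS, hSu⟩ := mem_cocompact.1 (h0.eventually (closedBall_mem_nhds 0 hδ))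
    obtain ⟨ρ, hρ⟩ := hS.isBounded.subset_closedBall 0
    exact ⟨ρ, fun x hx => hf' _ (by simpa using hSu fun h => hx (hρ h))⟩
  have hud : Differentiable ℝ u := hu.differentiable (by norm_num)
  rcases nonneg_or_nonpos_of_energyForm_nonneg hc (hu.partialDeriv (by norm_num) i)
    (tendsto_partialDeriv_cocompact hu h0 hL i)
    (fun ζ hζ hs => energyForm_partialDeriv_eq_zero hf hu heq i hζ hs) hρ
    (fun φ hφ hs => energyForm_nonneg_of_smooth hc hst hφ hs) with h | h
  · exact eq_zero_of_partialDeriv_nonneg hud h0 h x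
  · refine neg_eq_zero.1 (eq_zero_of_partialDeriv_nonneg (u := fun y => -u y) (i := i) hud.neg
      (by simpa using h0.neg) (fun y => ?_) x)
    rw [partialDeriv_neg]
    exact neg_nonneg.2 (h y)

end Stability

end

theorem stmt_9 {N : ℕ} (hN : 1 ≤ N) (f : ℝ → ℝ) (hf : ContDiff ℝ 1 f) (hf0 : f 0 = 0)
    (δ : ℝ) (hδ : 0 < δ) (hf' : ∀ s : ℝ, |s| ≤ δ → deriv f s ≤ 0)
    (u : EuclideanSpace ℝ (Fin N) → ℝ) (hu : ContDiff ℝ 2 u)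
    (heq : ∀ x, coordLaplacian u x + f (u x) = 0)
    (hnt : ∃ x, u x ≠ 0)
    (hloc : Tendsto u (cocompact (EuclideanSpace ℝ (Fin N))) (nhds 0)) :
    ∃ R > 0, ∃ φ : EuclideanSpace ℝ (Fin N) → ℝ, ContDiff ℝ (⊤ : ℕ∞) φ ∧
      tsupport φ ⊆ Metric.closedBall 0 R ∧
      (∫ x, (‖gradient φ x‖ ^ 2 - deriv f (u x) * (φ x) ^ 2)) < 0 := by
  by_contra! hcon
  obtain ⟨x, hx⟩ := hnt
  refine hx (eq_zero_of_energyForm_nonneg ⟨0, hN⟩ hf hf0 hδ hf' hu heq hloc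
    (fun φ hφ hs => ?_) x)
  obtain ⟨R, hR, hsub⟩ := hs.isBounded.subset_closedBall_lt 0 0
  refine (hcon R hR φ hφ hsub).trans_eq (integral_congr_ae (Eventually.of_forall fun y => ?_))
  simp only [norm_gradient_sq]
  ring
end
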